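/- arXiv:2603.19205 — 2 statements merged into one kernel-verified Lean document; each statement's English description precedes it below -/
import Mathlib

section
/- There exist a constant c > 0 and a threshold N₀ such that for every finite abelian group G with |G| = n ≥ N₀ and every ε ∈ G with ε² = 1, the following holds. Let Aut(G, ε) = {f ∈ Aut(G) : f(ε) = ε} act on subsets of G³ componentwise. Then the number of Aut(G, ε)-orbits of symmetric subsets that are hyperfield-defining with respect to ε and satisfy condition (⋆) is at least (1 − e^{−cn}) times the number of Aut(G, ε)-orbits of all symmetric subsets hyperfield-defining with respect to ε. -/
/-- A subset `S ⊆ G³` is symmetric if it is closed under all permutations of the three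
coordinates (swap and cycle generate `S₃`) and under the diagonal left-multiplication
action of `G`. -/
def IsSymmetric {G : Type*} [CommGroup G] (S : Set (G × G × G)) : Prop :=
  (∀ x y z : G, (x, y, z) ∈ S → (y, x, z) ∈ S) ∧
  (∀ x y z : G, (x, y, z) ∈ S → (y, z, x) ∈ S) ∧
  (∀ g x y z : G, (x, y, z) ∈ S → (g * x, g * y, g * z) ∈ S)

/-- A hexagon of an abelian group `G` is an orbit of `G³` under the combined action of
`G` (diagonal multiplication) and `S₃` (permutation of coordinates).
`hexRel v w` says that `w` lies in the orbit of `v`. -/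
def hexRel {G : Type*} [CommGroup G] (v w : G × G × G) : Prop :=
  ∃ g : G, w = (g * v.1, g * v.2.1, g * v.2.2) ∨ w = (g * v.1, g * v.2.2, g * v.2.1) ∨
    w = (g * v.2.1, g * v.1, g * v.2.2) ∨ w = (g * v.2.1, g * v.2.2, g * v.1) ∨
    w = (g * v.2.2, g * v.1, g * v.2.1) ∨ w = (g * v.2.2, g * v.2.1, g * v.1)

/-- A subset of `G³` is a hexagon if it is the orbit of some triple. -/
def IsHexagon {G : Type*} [CommGroup G] (H : Set (G × G × G)) : Prop :=
  ∃ v : G × G × G, H = {w | hexRel v w}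

/-- The number of hexagons of `G`. -/
noncomputable def numHexagons (G : Type*) [CommGroup G] : ℕ :=
  Nat.card {H : Set (G × G × G) // IsHexagon H}

/-- Condition (A) w.r.t. `ε`. -/
def CondA {G : Type*} [CommGroup G] (ε : G) (S : Set (G × G × G)) : Prop :=
  ∀ x : G, x ≠ ε → ∃ y : G, (x, y, 1) ∈ S

/-- Condition (B) w.r.t. `ε`. -/
def CondB {G : Type*} [CommGroup G] (ε : G) (S : Set (G × G × G)) : Prop :=
  ∀ x y z w : G, (x, y, 1) ∈ S → (z, w, 1) ∈ S → (x, y) ≠ (z, w) →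
    ∃ t : G, (t * x, ε * t * z, 1) ∈ S ∧ (ε * t * y, t * w, 1) ∈ S

/-- Condition (⋆). -/
def CondStar {G : Type*} [CommGroup G] (S : Set (G × G × G)) : Prop :=
  ∀ x y z w : G, ∃ t : G, (t * x, t * y, 1) ∈ S ∧ (t * z, t * w, 1) ∈ S

/-- The componentwise action of a map `f : G → G` on triples. -/
def tripleMap {G : Type*} (f : G → G) (v : G × G × G) : G × G × G :=
  (f v.1, f v.2.1, f v.2.2)

/-- The relation identifying two subsets of `G³` (within the collection of those
satisfying `P`) when some `ε`-preserving automorphism of `G` maps one onto the other. -/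
def autRel {G : Type*} [CommGroup G] (ε : G) (P : Set (G × G × G) → Prop)
    (S T : {S : Set (G × G × G) // P S}) : Prop :=
  ∃ f : G ≃* G, f ε = ε ∧ tripleMap f '' S.1 = T.1

/-- The number of `Aut(G, ε)`-orbits of subsets of `G³` satisfying `P`. -/
noncomputable def numOrbits {G : Type*} [CommGroup G] (ε : G)
    (P : Set (G × G × G) → Prop) : ℕ :=
  Nat.card (Quot (autRel ε P))

section Counting

open Finset

/-- If the sets `P i ⊆ U` are pairwise disjoint of size at most two, a subset of `U` contains
none of them with probability at most `(3/4) ^ #I`. -/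
lemma four_pow_mul_card_avoiding_le {Q ι : Type*} [DecidableEq Q] [DecidableEq ι]
    (P : ι → Finset Q) (hP : ∀ i, #(P i) ≤ 2) (I : Finset ι) (U : Finset Q)
    (hU : ∀ i ∈ I, P i ⊆ U) (hI : (I : Set ι).PairwiseDisjoint P) :
    4 ^ #I * #{T ∈ U.powerset | ∀ i ∈ I, ¬ P i ⊆ T} ≤ 3 ^ #I * 2 ^ #U := by
  induction I using Finset.induction_on generalizing U with
  | empty => simp
  | insert a I ha ih =>
    have haU : P a ⊆ U := hU a (mem_insert_self a I)
    have hdisj : ∀ i ∈ I, Disjoint (P i) (P a) := fun i hi =>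
      hI (by simp [hi]) (by simp) (by rintro rfl; exact ha hi)
    have hrec := ih (U \ P a)
      (fun i hi => subset_sdiff.2 ⟨hU i (mem_insert_of_mem hi), hdisj i hi⟩)
      (hI.subset (by simp))
    have hcard : #{T ∈ U.powerset | ∀ i ∈ insert a I, ¬ P i ⊆ T} ≤
        #((P a).powerset.erase (P a) ×ˢ
          {T ∈ (U \ P a).powerset | ∀ i ∈ I, ¬ P i ⊆ T}) := by
      refine card_le_card_of_injOn (fun T => (T ∩ P a, T \ P a)) ?_ ?_
      · intro T hT
        simp only [coe_filter, mem_powerset, Set.mem_ofPred_eq, forall_mem_insert] at hT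
        obtain ⟨hTU, hTa, hTI⟩ := hT
        simp only [coe_product, Set.mem_prod, mem_coe, mem_erase, mem_powerset, mem_filter]
        refine ⟨⟨fun h => hTa (inter_eq_right.1 h), inter_subset_right⟩,
          sdiff_subset_sdiff hTU subset_rfl, fun i hi h => hTI i hi (h.trans sdiff_subset)⟩
      · intro T _ T' _ h
        simp only [Prod.mk.injEq] at h
        rw [← sdiff_union_inter T (P a), ← sdiff_union_inter T' (P a), h.1, h.2]
    rw [card_product, card_erase_of_mem (by simp), card_powerset] at hcard
    have hsplit : 2 ^ #U = 2 ^ #(P a) * 2 ^ #(U \ P a) := by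
      rw [← pow_add, add_comm, card_sdiff_add_card_eq_card haU]
    have hpow : 4 * (2 ^ #(P a) - 1) ≤ 3 * 2 ^ #(P a) := by
      have := hP a
      interval_cases #(P a) <;> norm_num
    rw [card_insert_of_notMem ha, hsplit]
    calc _ ≤ 4 ^ (#I + 1) * ((2 ^ #(P a) - 1) *
            #{T ∈ (U \ P a).powerset | ∀ i ∈ I, ¬ P i ⊆ T}) := Nat.mul_le_mul_left _ hcard
      _ = (4 * (2 ^ #(P a) - 1)) *
            (4 ^ #I * #{T ∈ (U \ P a).powerset | ∀ i ∈ I, ¬ P i ⊆ T}) := by ring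
      _ ≤ (3 * 2 ^ #(P a)) * (3 ^ #I * 2 ^ #(U \ P a)) := Nat.mul_le_mul hpow hrec
      _ = _ := by ring

/-- Given two maps with fibres of size at most `k`, one can choose a proportion `1 / (4 * k)` of
the indices for which the sets `{a i, b i}` are pairwise disjoint. -/
lemma exists_pairwiseDisjoint_pairs {Q ι : Type*} [Fintype ι] [DecidableEq Q] [DecidableEq ι]
    (a b : ι → Q) (k : ℕ) (ha : ∀ q, #{i | a i = q} ≤ k) (hb : ∀ q, #{i | b i = q} ≤ k) :
    ∃ I : Finset ι, (I : Set ι).PairwiseDisjoint (fun i => ({a i, b i} : Finset Q)) ∧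
      Fintype.card ι ≤ 4 * k * #I := by
  classical
  obtain ⟨I, -, hI⟩ := Finite.exists_le_maximal (a := ∅)
    (p := fun I : Finset ι => (I : Set ι).PairwiseDisjoint (fun i => ({a i, b i} : Finset Q)))
    (by simp)
  refine ⟨I, hI.prop, ?_⟩
  let V : Finset Q := I.biUnion fun i => {a i, b i}
  have hV : #V ≤ #I * 2 := card_biUnion_le_card_mul _ _ _ fun i _ => card_le_two
  have hcover : (univ : Finset ι) ⊆
      V.biUnion fun q => ({i | a i = q} : Finset ι) ∪
        ({i | b i = q} : Finset ι) := by
    intro s _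
    by_contra hs
    have hav : a s ∉ V := fun h => hs (mem_biUnion.2 ⟨_, h, by simp⟩)
    have hbv : b s ∉ V := fun h => hs (mem_biUnion.2 ⟨_, h, by simp⟩)
    have hdisj : ∀ i ∈ I, Disjoint ({a s, b s} : Finset Q) {a i, b i} := by
      intro i hi
      have hsub : ({a i, b i} : Finset Q) ⊆ V := subset_biUnion_of_mem
        (fun i => ({a i, b i} : Finset Q)) hi
      refine disjoint_of_subset_right hsub ?_
      simp [hav, hbv]
    have hins : ((insert s I : Finset ι) : Set ι).PairwiseDisjoint
        (fun i => ({a i, b i} : Finset Q)) := by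
      rw [coe_insert]
      exact hI.prop.insert fun i hi _ => hdisj i hi
    have hsI : s ∈ I := hI.le_of_ge hins (subset_insert s I) (mem_insert_self s I)
    exact hav (mem_biUnion.2 ⟨s, hsI, by simp⟩)
  calc Fintype.card ι = #(univ : Finset ι) := rfl
    _ ≤ #V * (k + k) := (card_le_card hcover).trans <| card_biUnion_le_card_mul _ _ _
        fun q _ => (card_union_le _ _).trans (Nat.add_le_add (ha q) (hb q))
    _ ≤ (#I * 2) * (k + k) := Nat.mul_le_mul_right _ hV
    _ = 4 * k * #I := by ring

end Counting

section Automorphisms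

/-- A finite group has a generating set `S` with `2 ^ #S ≤ |G|`. -/
lemma exists_closure_eq_top_two_pow_card_le (G : Type*) [Group G] [Finite G] :
    ∃ S : Finset G, Subgroup.closure (S : Set G) = ⊤ ∧ 2 ^ S.card ≤ Nat.card G := by
  classical
  obtain ⟨S, -, hS⟩ := Finite.exists_le_maximal (a := ∅)
    (p := fun S : Finset G => 2 ^ S.card ≤ Nat.card (Subgroup.closure (S : Set G))) (by simp)
  refine ⟨S, ?_, hS.prop.trans (Subgroup.card_le_card_group _)⟩
  by_contra htop
  obtain ⟨g, hg⟩ : ∃ g, g ∉ Subgroup.closure (S : Set G) := by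
    by_contra! h
    exact htop ((Subgroup.eq_top_iff' _).2 h)
  have hle : Subgroup.closure (S : Set G) ≤ Subgroup.closure ((insert g S : Finset G) : Set G) :=
    Subgroup.closure_mono (by simp)
  have hgmem : g ∈ Subgroup.closure ((insert g S : Finset G) : Set G) :=
    Subgroup.subset_closure (by simp)
  obtain ⟨m, hm⟩ := Subgroup.card_dvd_of_le hle
  have hpos : 0 < Nat.card (Subgroup.closure ((insert g S : Finset G) : Set G)) := Nat.card_pos
  have hm2 : 2 ≤ m := by
    by_contra! hlt
    interval_cases m
    · omega
    · exact hg (Subgroup.eq_of_le_of_card_ge hle (by omega) ▸ hgmem)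
  have hgS : g ∉ S := fun h => hg (Subgroup.subset_closure h)
  have hins : 2 ^ (insert g S).card ≤
      Nat.card (Subgroup.closure ((insert g S : Finset G) : Set G)) := by
    rw [Finset.card_insert_of_notMem hgS, hm, pow_succ]
    exact Nat.mul_le_mul hS.prop hm2
  exact hgS (hS.le_of_ge hins (Finset.subset_insert g S) (Finset.mem_insert_self g S))

lemma exists_card_mulEquiv_le_pow (G : Type*) [Group G] [Finite G] :
    ∃ k : ℕ, 2 ^ k ≤ Nat.card G ∧ Nat.card (G ≃* G) ≤ Nat.card G ^ k := by
  obtain ⟨S, hS, hcard⟩ := exists_closure_eq_top_two_pow_card_le G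
  refine ⟨S.card, hcard, ?_⟩
  have hinj : Function.Injective (fun (f : G ≃* G) (s : S) => f s) := by
    intro f f' h
    have : f.toMonoidHom = f'.toMonoidHom :=
      MonoidHom.eq_of_eqOn_dense hS fun s hs => congrFun h ⟨s, hs⟩
    ext x
    exact DFunLike.congr_fun this x
  simpa [Nat.card_fun] using Nat.card_le_card_of_injective _ hinj

end Automorphisms

section Orbits

variable {G : Type*} [CommGroup G]

lemma autRel_equivalence (ε : G) (P : Set (G × G × G) → Prop) : Equivalence (autRel ε P) where
  refl S := ⟨MulEquiv.refl G, rfl, Set.image_id _⟩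
  symm := by
    rintro S T ⟨f, hf, hST⟩
    refine ⟨f.symm, by rw [MulEquiv.symm_apply_eq, hf], ?_⟩
    rw [← hST, Set.image_image]
    simp [tripleMap]
  trans := by
    rintro S T U ⟨f, hf, hST⟩ ⟨f', hf', hTU⟩
    refine ⟨f.trans f', by simp [hf, hf'], ?_⟩
    rw [← hTU, ← hST, Set.image_image]
    rfl

lemma card_subtype_le_card_mulEquiv_mul_numOrbits [Finite G] (ε : G)
    (P : Set (G × G × G) → Prop) :
    Nat.card {S // P S} ≤ Nat.card (G ≃* G) * numOrbits ε P := by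
  have hout : ∀ S : {S // P S}, autRel ε P (Quot.mk (autRel ε P) S).out S := fun S =>
    (autRel_equivalence ε P).eqvGen_iff.1 (Quot.eqvGen_exact (Quot.out_eq _))
  choose f _ hf using hout
  have : Finite (G ≃* G) := Finite.of_injective _ (DFunLike.coe_injective (F := G ≃* G))
  rw [numOrbits, ← Nat.card_prod]
  refine Nat.card_le_card_of_injective (fun S => (f S, Quot.mk (autRel ε P) S)) ?_
  intro S T h
  simp only [Prod.mk.injEq] at h
  apply Subtype.ext
  rw [← hf S, ← hf T, h.1, h.2]

lemma numOrbits_le_add_card [Finite G] (ε : G) (P P' : Set (G × G × G) → Prop)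
    (h : ∀ S, P' S → P S) :
    numOrbits ε P ≤ numOrbits ε P' + Nat.card {S // P S ∧ ¬ P' S} := by
  rw [numOrbits, numOrbits, ← Nat.card_sum]
  refine Nat.card_le_card_of_surjective
    (Sum.elim (Quot.map (fun S : {S // P' S} => (⟨S.1, h _ S.2⟩ : {S // P S})) fun _ _ hST => hST)
      fun S => Quot.mk _ ⟨S.1, S.2.1⟩) ?_
  rintro ⟨S, hS⟩
  by_cases hS' : P' S
  · exact ⟨Sum.inl (Quot.mk _ ⟨S, hS'⟩), rfl⟩
  · exact ⟨Sum.inr ⟨S, hS, hS'⟩, rfl⟩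

end Orbits

section Hexagons

variable {G : Type*} [CommGroup G]

lemma isSymmetric_setOf_hexRel (v : G × G × G) : IsSymmetric {w | hexRel v w} := by
  refine ⟨?_, ?_, ?_⟩
  · rintro x y z ⟨g, h⟩
    simp only [Prod.mk.injEq] at h
    refine ⟨g, ?_⟩
    simp only [Prod.mk.injEq]
    tauto
  · rintro x y z ⟨g, h⟩
    simp only [Prod.mk.injEq] at h
    refine ⟨g, ?_⟩
    simp only [Prod.mk.injEq]
    tauto
  · rintro k x y z ⟨g, h⟩
    simp only [Prod.mk.injEq] at h
    refine ⟨k * g, ?_⟩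
    simp only [Prod.mk.injEq, mul_assoc, mul_right_inj]
    exact h

/-- Two triples are equivalent when no symmetric set separates them; the classes are the
hexagons. -/
def hexSetoid (G : Type*) [CommGroup G] : Setoid (G × G × G) where
  r v w := ∀ S, IsSymmetric S → (v ∈ S ↔ w ∈ S)
  iseqv := ⟨fun _ _ _ => Iff.rfl, fun h S hS => (h S hS).symm,
    fun h h' S hS => (h S hS).trans (h' S hS)⟩

lemma hexRel_of_mk_eq {v w : G × G × G}
    (h : Quotient.mk (hexSetoid G) v = Quotient.mk (hexSetoid G) w) : hexRel v w :=
  (Quotient.exact h _ (isSymmetric_setOf_hexRel v)).1 ⟨1, by simp⟩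

lemma isSymmetric_preimage_mk (T : Set (Quotient (hexSetoid G))) :
    IsSymmetric (Quotient.mk (hexSetoid G) ⁻¹' T) := by
  have key : ∀ v w : G × G × G, (hexSetoid G).r v w →
      v ∈ Quotient.mk (hexSetoid G) ⁻¹' T → w ∈ Quotient.mk (hexSetoid G) ⁻¹' T := by
    intro v w h hv
    rw [Set.mem_preimage] at hv ⊢
    rwa [← Quotient.sound (s := hexSetoid G) h]
  refine ⟨fun x y z => key _ _ fun S hS => ⟨hS.1 _ _ _, hS.1 _ _ _⟩,
    fun x y z => key _ _ fun S hS => ⟨hS.2.1 _ _ _, fun h => hS.2.1 _ _ _ (hS.2.1 _ _ _ h)⟩,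
    fun g x y z => key _ _ fun S hS => ⟨hS.2.2 _ _ _ _, fun h => ?_⟩⟩
  simpa using hS.2.2 g⁻¹ _ _ _ h

lemma IsSymmetric.preimage_image_mk {S : Set (G × G × G)} (hS : IsSymmetric S) :
    Quotient.mk (hexSetoid G) ⁻¹' (Quotient.mk (hexSetoid G) '' S) = S := by
  refine subset_antisymm ?_ (Set.subset_preimage_image _ _)
  rintro v ⟨w, hw, hwv⟩
  exact (Quotient.exact hwv S hS).1 hw

lemma IsSymmetric.condStar {S : Set (G × G × G)} (hS : IsSymmetric S)
    (h : ∀ x y z w : G, ∃ s, (x, y, s) ∈ S ∧ (z, w, s) ∈ S) : CondStar S := by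
  intro x y z w
  obtain ⟨s, h₁, h₂⟩ := h x y z w
  exact ⟨s⁻¹, by simpa using hS.2.2 s⁻¹ _ _ _ h₁, by simpa using hS.2.2 s⁻¹ _ _ _ h₂⟩

lemma CondStar.condA {S : Set (G × G × G)} (hS : IsSymmetric S) (h : CondStar S) (ε : G) :
    CondA ε S := by
  intro x _
  obtain ⟨t, ht, _⟩ := h x 1 1 1
  refine ⟨t⁻¹, ?_⟩
  have h₁ := hS.2.2 t⁻¹ _ _ _ ht
  simp only [inv_mul_cancel_left, inv_mul_cancel, mul_one] at h₁
  exact hS.2.1 _ _ _ (hS.1 _ _ _ h₁)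

lemma CondStar.condB {S : Set (G × G × G)} (h : CondStar S) (ε : G) : CondB ε S := by
  intro x y z w _ _ _
  obtain ⟨t, h₁, h₂⟩ := h x (ε * z) (ε * y) w
  refine ⟨t, ?_, ?_⟩
  · rwa [mul_comm ε t, mul_assoc]
  · rwa [mul_comm ε t, mul_assoc]

open Finset in
lemma card_filter_mk_eq_le_six [Fintype G] [DecidableEq (Quotient (hexSetoid G))] (x y : G)
    (q : Quotient (hexSetoid G)) : #{s : G | Quotient.mk (hexSetoid G) (x, y, s) = q} ≤ 6 := by
  classical
  rcases ({s : G | Quotient.mk (hexSetoid G) (x, y, s) = q} : Finset G).eq_empty_or_nonempty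
    with h | ⟨r, hr⟩
  · simp [h]
  · refine (card_le_card (t := {r, y, x * y⁻¹ * r, x * y⁻¹ * x, x * r⁻¹ * y, x * r⁻¹ * x}) ?_).trans
      card_le_six
    intro s hs
    simp only [mem_filter, mem_univ, true_and] at hr hs
    obtain ⟨g, h⟩ := hexRel_of_mk_eq (hr.trans hs.symm)
    simp only [Prod.mk.injEq] at h
    have hg : ∀ u : G, x = g * u → g = x * u⁻¹ := fun u hu => eq_mul_inv_of_mul_eq hu.symm
    simp only [mem_insert, mem_singleton]
    rcases h with ⟨h₁, h₂, h₃⟩ | ⟨h₁, h₂, h₃⟩ | ⟨h₁, h₂, h₃⟩ | ⟨h₁, h₂, h₃⟩ | ⟨h₁, h₂, h₃⟩ |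
      ⟨h₁, h₂, h₃⟩ <;> rw [hg _ h₁] at h₃ <;> simp [h₃]

open Finset in
/-- Writing symmetric sets as unions of hexagons, the proportion of those for which the
pairs `(x, y)` and `(z, w)` have no common completion is exponentially small. -/
lemma exists_four_pow_mul_card_le [Fintype G] [Fintype (Quotient (hexSetoid G))]
    [DecidableEq (Quotient (hexSetoid G))] (x y z w : G) :
    ∃ m : ℕ, Fintype.card G ≤ 24 * m ∧
      4 ^ m * #{T : Finset (Quotient (hexSetoid G)) | ∀ s : G,
        ¬ (Quotient.mk (hexSetoid G) (x, y, s) ∈ T ∧ Quotient.mk (hexSetoid G) (z, w, s) ∈ T)} ≤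
      3 ^ m * 2 ^ Fintype.card (Quotient (hexSetoid G)) := by
  classical
  obtain ⟨I, hI, hcard⟩ := exists_pairwiseDisjoint_pairs
    (fun s : G => Quotient.mk (hexSetoid G) (x, y, s))
    (fun s : G => Quotient.mk (hexSetoid G) (z, w, s)) 6
    (card_filter_mk_eq_le_six x y) (card_filter_mk_eq_le_six z w)
  refine ⟨#I, hcard, ?_⟩
  refine le_trans (Nat.mul_le_mul_left _ (card_le_card ?_))
    (four_pow_mul_card_avoiding_le _ (fun _ => card_le_two) I univ (fun _ _ => subset_univ _) hI)
  intro T hT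
  simp only [mem_filter, mem_univ, true_and] at hT
  simp only [powerset_univ, mem_filter, mem_univ, true_and, insert_subset_iff,
    singleton_subset_iff]
  exact fun s _ => hT s

open Finset in
lemma card_filter_not_condStar_le [Fintype G] [Fintype (Quotient (hexSetoid G))]
    [DecidablePred fun T : Finset (Quotient (hexSetoid G)) =>
      ¬ CondStar (Quotient.mk (hexSetoid G) ⁻¹' (T : Set (Quotient (hexSetoid G))))] :
    (#{T : Finset (Quotient (hexSetoid G)) |
        ¬ CondStar (Quotient.mk (hexSetoid G) ⁻¹' (T : Set (Quotient (hexSetoid G))))} : ℝ) ≤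
      Fintype.card G ^ 4 * (Real.exp (-(Fintype.card G / 96)) *
        2 ^ Fintype.card (Quotient (hexSetoid G))) := by
  classical
  let B : G × G × G × G → Finset (Finset (Quotient (hexSetoid G))) := fun p =>
    {T | ∀ s : G, ¬ (Quotient.mk (hexSetoid G) (p.1, p.2.1, s) ∈ T ∧
      Quotient.mk (hexSetoid G) (p.2.2.1, p.2.2.2, s) ∈ T)}
  have hB : ∀ p, (#(B p) : ℝ) ≤ Real.exp (-(Fintype.card G / 96)) *
      2 ^ Fintype.card (Quotient (hexSetoid G)) := by
    rintro ⟨x, y, z, w⟩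
    obtain ⟨m, hm, hle⟩ := exists_four_pow_mul_card_le x y z w
    have hmR : (Fintype.card G : ℝ) ≤ 24 * m := by exact_mod_cast hm
    have hleR : (4 : ℝ) ^ m * #(B (x, y, z, w)) ≤
        3 ^ m * 2 ^ Fintype.card (Quotient (hexSetoid G)) := by exact_mod_cast hle
    have hbase : (3 / 4 : ℝ) ≤ Real.exp (-(1 / 4)) := by
      have := Real.add_one_le_exp (-(1 / 4) : ℝ)
      linarith
    have hexp : (3 / 4 : ℝ) ^ m ≤ Real.exp (-(Fintype.card G / 96)) := by
      calc (3 / 4 : ℝ) ^ m ≤ Real.exp (-(1 / 4)) ^ m := by gcongr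
        _ = Real.exp (m * -(1 / 4)) := (Real.exp_nat_mul _ _).symm
        _ ≤ _ := Real.exp_le_exp.2 (by linarith)
    calc (#(B (x, y, z, w)) : ℝ) ≤ (3 / 4) ^ m * 2 ^ Fintype.card (Quotient (hexSetoid G)) := by
          rw [div_pow, div_mul_eq_mul_div, le_div_iff₀ (by positivity)]
          linarith
      _ ≤ _ := by gcongr
  have hsub : ({T | ¬ CondStar (Quotient.mk (hexSetoid G) ⁻¹'
      (T : Set (Quotient (hexSetoid G))))} : Finset (Finset (Quotient (hexSetoid G)))) ⊆
      univ.biUnion B := by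
    intro T hT
    simp only [mem_filter, mem_univ, true_and] at hT
    contrapose! hT
    refine (isSymmetric_preimage_mk _).condStar fun x y z w => ?_
    by_contra! h
    exact hT (mem_biUnion.2 ⟨(x, y, z, w), mem_univ _, by simpa [B] using h⟩)
  calc _ ≤ ((∑ p, #(B p) : ℕ) : ℝ) := by exact_mod_cast (card_le_card hsub).trans card_biUnion_le
    _ ≤ ∑ _p : G × G × G × G, Real.exp (-(Fintype.card G / 96)) *
        2 ^ Fintype.card (Quotient (hexSetoid G)) := by
      push_cast
      exact sum_le_sum fun p _ => hB p
    _ = _ := by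
      simp only [sum_const, card_univ, Fintype.card_prod, nsmul_eq_mul, Nat.cast_mul]
      ring

end Hexagons

lemma eventually_two_mul_pow_mul_exp_le :
    ∃ N₀ : ℕ, ∀ n k : ℕ, N₀ ≤ n → 2 ^ k ≤ n →
      2 * ((n : ℝ) ^ 4 * Real.exp (-(n / 96))) * (n : ℝ) ^ k ≤ Real.exp (-(1 / 192 * n)) := by
  have hlittle := (Real.isLittleO_pow_log_id_atTop (n := 2)).bound
    (show (0 : ℝ) < 1 / 1536 by norm_num)
  obtain ⟨N, hN⟩ := Filter.eventually_atTop.1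
    (tendsto_natCast_atTop_atTop.eventually hlittle)
  refine ⟨max N 3, fun n k hn hk => ?_⟩
  have hn3 : (3 : ℝ) ≤ n := by exact_mod_cast (le_max_right N 3).trans hn
  have hn0 : (0 : ℝ) < n := by linarith
  have hbound := hN n ((le_max_left N 3).trans hn)
  simp only [id, Real.norm_eq_abs, abs_of_pos hn0, abs_pow, sq_abs] at hbound
  have hL : 1 ≤ Real.log n := by
    rw [Real.le_log_iff_exp_le hn0]
    exact Real.exp_one_lt_three.le.trans hn3
  have hkL : (k : ℝ) ≤ 2 * Real.log n := by
    have h₁ : Real.log ((2 : ℝ) ^ k) ≤ Real.log n :=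
      Real.log_le_log (by positivity) (by exact_mod_cast hk)
    rw [Real.log_pow] at h₁
    nlinarith [Real.log_two_gt_d9, (Nat.cast_nonneg k : (0 : ℝ) ≤ k)]
  have hpow : ∀ j : ℕ, (n : ℝ) ^ j = Real.exp (j * Real.log n) := fun j => by
    rw [Real.exp_nat_mul, Real.exp_log hn0]
  have htwo : (2 : ℝ) ≤ Real.exp 1 := by linarith [Real.add_one_le_exp (1 : ℝ)]
  calc 2 * ((n : ℝ) ^ 4 * Real.exp (-(n / 96))) * (n : ℝ) ^ k
      ≤ Real.exp 1 * ((n : ℝ) ^ 4 * Real.exp (-(n / 96))) * (n : ℝ) ^ k := by gcongr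
    _ = Real.exp (1 + (4 * Real.log n + -(n / 96)) + k * Real.log n) := by
      rw [hpow 4, hpow k, Real.exp_add, Real.exp_add, Real.exp_add]
      norm_num
    _ ≤ _ := Real.exp_le_exp.2 (by nlinarith)

/-- there are `c > 0` and `N₀` such that for every finite abelian group `G`
of order `n ≥ N₀` and every `ε ∈ G` with `ε² = 1`, the number of `Aut(G, ε)`-orbits of
symmetric subsets that are hyperfield-defining w.r.t. `ε` and satisfy (⋆) is at least
`(1 - e^{-cn})` times the number of `Aut(G, ε)`-orbits of all symmetric subsets
hyperfield-defining w.r.t. `ε`. -/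
theorem stmt16 :
    ∃ c : ℝ, 0 < c ∧ ∃ N₀ : ℕ, ∀ (G : Type) [CommGroup G] [Fintype G],
      N₀ ≤ Fintype.card G → ∀ ε : G, ε ^ 2 = 1 →
      (1 - Real.exp (-(c * Fintype.card G))) *
          (numOrbits ε (fun S => IsSymmetric S ∧ CondA ε S ∧ CondB ε S) : ℝ) ≤
        (numOrbits ε
          (fun S => IsSymmetric S ∧ CondA ε S ∧ CondB ε S ∧ CondStar S) : ℝ) := by
  classical
  obtain ⟨N₀, hN₀⟩ := eventually_two_mul_pow_mul_exp_le
  refine ⟨1 / 192, by norm_num, N₀, fun G _ _ hn ε _ => ?_⟩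
  have : Finite (Quotient (hexSetoid G)) := Quotient.finite _
  have : Fintype (Quotient (hexSetoid G)) := Fintype.ofFinite _
  let e : Finset (Quotient (hexSetoid G)) → Set (G × G × G) :=
    fun T => Quotient.mk (hexSetoid G) ⁻¹' (T : Set (Quotient (hexSetoid G)))
  have he : Function.Injective e := fun T T' h => Finset.coe_injective
    (Quotient.mk_surjective.preimage_injective h)
  set P : Set (G × G × G) → Prop := fun S => IsSymmetric S ∧ CondA ε S ∧ CondB ε S
  set P' : Set (G × G × G) → Prop := fun S => IsSymmetric S ∧ CondA ε S ∧ CondB ε S ∧ CondStar S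
  set E := Real.exp (-(1 / 192 * (Fintype.card G : ℝ)))
  set δ := (Fintype.card G : ℝ) ^ 4 * Real.exp (-(Fintype.card G / 96))
  set M : ℝ := 2 ^ Fintype.card (Quotient (hexSetoid G))
  have hgood : Finset.card {T | CondStar (e T)} ≤ Nat.card {S // P' S} := by
    rw [← Fintype.card_subtype, ← Nat.card_eq_fintype_card]
    refine Nat.card_le_card_of_injective (fun T => ⟨e T.1, isSymmetric_preimage_mk _,
      T.2.condA (isSymmetric_preimage_mk _) ε, T.2.condB ε, T.2⟩) fun T T' h => ?_
    exact Subtype.ext (he (congrArg Subtype.val h))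
  have hbad : Nat.card {S // P S ∧ ¬ P' S} ≤ Finset.card {T | ¬ CondStar (e T)} := by
    rw [← Fintype.card_subtype, ← Nat.card_eq_fintype_card]
    have hmk : ∀ S : {S // P S ∧ ¬ P' S}, e (Quotient.mk (hexSetoid G) '' S.1).toFinset = S.1 :=
      fun S => by simpa [e] using S.2.1.1.preimage_image_mk
    have hstar : ∀ S : {S // P S ∧ ¬ P' S},
        ¬ CondStar (e (Quotient.mk (hexSetoid G) '' S.1).toFinset) := fun S h => by
      rw [hmk S] at h
      exact S.2.2 ⟨S.2.1.1, S.2.1.2.1, S.2.1.2.2, h⟩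
    refine Nat.card_le_card_of_injective (fun S => ⟨_, hstar S⟩) fun S T h => Subtype.ext ?_
    rw [← hmk S, ← hmk T, Subtype.mk.inj h]
  have hsum : (Finset.card {T | CondStar (e T)} : ℝ) + Finset.card {T | ¬ CondStar (e T)} = M := by
    have := Finset.card_filter_add_card_filter_not
      (s := (Finset.univ : Finset (Finset (Quotient (hexSetoid G))))) (fun T => CondStar (e T))
    rw [Finset.card_univ, Fintype.card_finset] at this
    simp only [M]
    exact_mod_cast this
  have hδ : (Finset.card {T | ¬ CondStar (e T)} : ℝ) ≤ δ * M := by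
    rw [mul_assoc]
    exact card_filter_not_condStar_le
  have horb : (Nat.card {S // P' S} : ℝ) ≤ Nat.card (G ≃* G) * numOrbits ε P' := by
    exact_mod_cast card_subtype_le_card_mulEquiv_mul_numOrbits ε P'
  have htot : (numOrbits ε P : ℝ) ≤ numOrbits ε P' + Nat.card {S // P S ∧ ¬ P' S} := by
    exact_mod_cast numOrbits_le_add_card ε P P' fun S hS => ⟨hS.1, hS.2.1, hS.2.2.1⟩
  obtain ⟨k, hk, hAut⟩ := exists_card_mulEquiv_le_pow G
  rw [Nat.card_eq_fintype_card (α := G)] at hk hAut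
  have hE : 2 * δ * (Fintype.card G : ℝ) ^ k ≤ E := hN₀ _ k hn hk
  have hAutR : (Nat.card (G ≃* G) : ℝ) ≤ (Fintype.card G : ℝ) ^ k :=
    (Nat.cast_le.2 hAut).trans_eq (Nat.cast_pow _ _)
  have hk1 : (1 : ℝ) ≤ (Fintype.card G : ℝ) ^ k :=
    one_le_pow₀ (by exact_mod_cast Fintype.card_pos)
  have hE0 : 0 < E := Real.exp_pos _
  have hE1 : E ≤ 1 := Real.exp_le_one_iff.2 (by simp)
  have hδ0 : 0 ≤ δ := by positivity
  have hM0 : 0 < M := by positivity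
  have hδ2 : 2 * δ ≤ 1 := by nlinarith
  have hgoodR : (Finset.card {T | CondStar (e T)} : ℝ) ≤ Nat.card {S // P' S} := by
    exact_mod_cast hgood
  have hbadR : (Nat.card {S // P S ∧ ¬ P' S} : ℝ) ≤ Finset.card {T | ¬ CondStar (e T)} := by
    exact_mod_cast hbad
  have horb0 : (0 : ℝ) ≤ numOrbits ε P' := Nat.cast_nonneg _
  have hhalf : M ≤ 2 * ((Fintype.card G : ℝ) ^ k * numOrbits ε P') := by
    have : (Nat.card (G ≃* G) : ℝ) * numOrbits ε P' ≤
        (Fintype.card G : ℝ) ^ k * numOrbits ε P' := by gcongr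
    nlinarith
  have hsmall : (Nat.card {S // P S ∧ ¬ P' S} : ℝ) ≤ E * numOrbits ε P' := by
    calc _ ≤ δ * M := hbadR.trans hδ
      _ ≤ δ * (2 * ((Fintype.card G : ℝ) ^ k * numOrbits ε P')) := by gcongr
      _ = (2 * δ * (Fintype.card G : ℝ) ^ k) * numOrbits ε P' := by ring
      _ ≤ _ := by gcongr
  have hbad0 : (0 : ℝ) ≤ Nat.card {S // P S ∧ ¬ P' S} := Nat.cast_nonneg _
  calc (1 - E) * (numOrbits ε P : ℝ)
      ≤ (1 - E) * (numOrbits ε P' + Nat.card {S // P S ∧ ¬ P' S}) :=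
        mul_le_mul_of_nonneg_left htot (by linarith)
    _ ≤ numOrbits ε P' := by nlinarith
end

section
/- There exist constants c, C > 0 and a threshold N₀ such that for every finite abelian group G of order n ≥ N₀ the following holds. Let 𝒩(G) be the number of orbits, under the action of Aut(G) on pairs given by f·(ε, S) = (f(ε), f(S)), of pairs (ε, S) where ε ∈ G satisfies ε² = 1 and S ⊆ G³ is a symmetric subset hyperfield-defining with respect to ε. Let M = (|G[2]| / |Aut(G)|) · 2^{(n² + 3n + 2|G[3]|)/6}, where G[2] and G[3] denote the 2-torsion and 3-torsion subgroups of G (the exponent is an integer). Then M·e^{−Cn} ≤ M − 𝒩(G) ≤ M·e^{−cn}; in particular 𝒩(G) = (1 − e^{−Θ(n)})·M. -/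
/-- The relation identifying two pairs `(ε, S)`—with `ε² = 1` and `S` symmetric and
hyperfield-defining w.r.t. `ε`—when some automorphism of `G` carries one to the other. -/
def hfPairRel (G : Type*) [CommGroup G]
    (p q : {p : G × Set (G × G × G) //
      p.1 ^ 2 = 1 ∧ IsSymmetric p.2 ∧ CondA p.1 p.2 ∧ CondB p.1 p.2}) : Prop :=
  ∃ f : G ≃* G, f p.1.1 = q.1.1 ∧ tripleMap f '' p.1.2 = q.1.2

/-- The number of isomorphism classes of hyperfields with underlying group `G`, i.e. the
number of `Aut(G)`-orbits of hyperfield-defining pairs `(ε, S)`. -/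
noncomputable def numHFClasses (G : Type*) [CommGroup G] : ℕ :=
  Nat.card (Quot (hfPairRel G))

theorem four_mul_card_filter_inter_ne_le {α : Type*} [DecidableEq α]
    (A : Finset (Finset α)) {D F : Finset α} (hF : F ⊆ D) (hD : D.card ≤ 2)
    (hA : ∀ S ∈ A, S \ D ∪ F ∈ A) :
    4 * (A.filter fun S => S ∩ D ≠ F).card ≤ 3 * A.card := by
  have hsplit := Finset.card_filter_add_card_filter_not (s := A) (fun S => S ∩ D = F)
  have hfib : A.card ≤ 4 * (A.filter fun S => S ∩ D = F).card := by
    refine Finset.card_le_mul_card_image_of_maps_to (f := fun S => S \ D ∪ F) ?_ 4 ?_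
    · intro S hS
      refine Finset.mem_filter.2 ⟨hA S hS, ?_⟩
      ext a
      have := @hF a
      simp only [Finset.mem_inter, Finset.mem_union, Finset.mem_sdiff]
      tauto
    · intro R _
      calc (A.filter fun S => S \ D ∪ F = R).card ≤ D.powerset.card := by
            refine Finset.card_le_card_of_injOn (fun S => S ∩ D) ?_ ?_
            · intro S _
              simp
            · intro S hS S' hS' h
              have hS := (Finset.mem_filter.1 hS).2
              have hS' := (Finset.mem_filter.1 hS').2
              ext a
              have h₁ := Finset.ext_iff.1 h a
              have h₂ := Finset.ext_iff.1 (hS.trans hS'.symm) a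
              have h₃ := @hF a
              simp only [Finset.mem_inter, Finset.mem_union, Finset.mem_sdiff] at h₁ h₂
              tauto
        _ = 2 ^ D.card := Finset.card_powerset D
        _ ≤ 2 ^ 2 := Nat.pow_le_pow_right (by norm_num) hD
  have : (A.filter fun S => ¬ S ∩ D = F).card = (A.filter fun S => S ∩ D ≠ F).card := rfl
  lia

theorem four_pow_mul_card_forall_inter_ne_le {α ι : Type*} [Fintype α] [DecidableEq α]
    {D F : ι → Finset α} (hF : ∀ i, F i ⊆ D i) (hD : ∀ i, (D i).card ≤ 2)
    {K : ℕ} (hK : 0 < K) (k : ℕ) (T : Finset ι)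
    (hT : ∀ a, (T.filter fun i => a ∈ D i).card ≤ K) (hk : 2 * K * k ≤ T.card) :
    4 ^ k * (Finset.univ.filter fun S : Finset α => ∀ i ∈ T, S ∩ D i ≠ F i).card ≤
      3 ^ k * 2 ^ Fintype.card α := by
  classical
  induction k generalizing T with
  | zero =>
    simpa using Finset.card_le_univ (Finset.univ.filter fun S : Finset α => ∀ i ∈ T, S ∩ D i ≠ F i)
  | succ k ih =>
    obtain ⟨i₀, hi₀⟩ : T.Nonempty := by
      rw [← Finset.card_pos]
      nlinarith
    set T' := T.filter fun i => Disjoint (D i) (D i₀) with hT'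
    have hcard : T.card ≤ T'.card + 2 * K := by
      rw [← Finset.card_filter_add_card_filter_not (s := T) (fun i => Disjoint (D i) (D i₀))]
      gcongr
      calc (T.filter fun i => ¬ Disjoint (D i) (D i₀)).card
          ≤ ((D i₀).biUnion fun a => T.filter fun i => a ∈ D i).card := by
            refine Finset.card_le_card fun i hi => ?_
            obtain ⟨hi, h⟩ := Finset.mem_filter.1 hi
            obtain ⟨a, ha, ha'⟩ := Finset.not_disjoint_iff.1 h
            exact Finset.mem_biUnion.2 ⟨a, ha', Finset.mem_filter.2 ⟨hi, ha⟩⟩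
        _ ≤ (D i₀).card * K := Finset.card_biUnion_le_card_mul _ _ _ fun a _ => hT a
        _ ≤ 2 * K := Nat.mul_le_mul_right _ (hD i₀)
    have ih' := ih T' (fun a => (Finset.card_le_card
      (Finset.filter_subset_filter _ (Finset.filter_subset _ _))).trans (hT a)) (by lia)
    set A := Finset.univ.filter fun S : Finset α => ∀ i ∈ T', S ∩ D i ≠ F i with hAdef
    have hstep := four_mul_card_filter_inter_ne_le A (hF i₀) (hD i₀) (by
      intro S hS
      simp only [hAdef, Finset.mem_filter, Finset.mem_univ, true_and] at hS ⊢
      intro i hi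
      have hdis := Finset.disjoint_left.1 (Finset.mem_filter.1 hi).2
      convert hS i hi using 1
      ext a
      have := @hdis a
      have := @hF i₀ a
      simp only [Finset.mem_inter, Finset.mem_union, Finset.mem_sdiff]
      tauto)
    have hle : (Finset.univ.filter fun S : Finset α => ∀ i ∈ T, S ∩ D i ≠ F i).card ≤
        (A.filter fun S => S ∩ D i₀ ≠ F i₀).card := by
      refine Finset.card_le_card fun S hS => ?_
      have hS := (Finset.mem_filter.1 hS).2
      simp only [hAdef, Finset.mem_filter, Finset.mem_univ, true_and]
      exact ⟨fun i hi => hS i (Finset.mem_filter.1 hi).1, hS i₀ hi₀⟩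
    calc _ ≤ 4 ^ (k + 1) * (A.filter fun S => S ∩ D i₀ ≠ F i₀).card := by gcongr
      _ = 4 ^ k * (4 * (A.filter fun S => S ∩ D i₀ ≠ F i₀).card) := by ring
      _ ≤ 4 ^ k * (3 * A.card) := by gcongr
      _ = 3 * (4 ^ k * A.card) := by ring
      _ ≤ 3 * (3 ^ k * 2 ^ Fintype.card α) := by gcongr
      _ = _ := by ring


/-- Triples of elements of `G`, on which `G` acts diagonally and `S₃` acts by permuting the
coordinates. -/
def Triple (G : Type*) := Fin 3 → G

instance {G : Type*} [CommGroup G] : MulAction (G × Equiv.Perm (Fin 3)) (Triple G) where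
  smul a v := fun i => a.1 * v (a.2⁻¹ i)
  one_smul v := funext fun i => one_mul _
  mul_smul a b v := funext fun i => by
    change a.1 * b.1 * v ((a.2 * b.2)⁻¹ i) = a.1 * (b.1 * v (b.2⁻¹ (a.2⁻¹ i)))
    rw [mul_inv_rev, Equiv.Perm.mul_apply, mul_assoc]

instance {G : Type*} [Fintype G] : Fintype (Triple G) :=
  inferInstanceAs (Fintype (Fin 3 → G))

theorem Triple.smul_eq_iff {G : Type*} [CommGroup G] (a : G × Equiv.Perm (Fin 3))
    (v w : Triple G) : a • v = w ↔ ∀ i, a.1 * v (a.2⁻¹ i) = w i := funext_iff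

theorem univ_perm_fin_three : (Finset.univ : Finset (Equiv.Perm (Fin 3))) =
    {1, Equiv.swap 0 1, Equiv.swap 0 2, Equiv.swap 1 2, finRotate 3, (finRotate 3)⁻¹} := by
  decide

/-- The set of hexagons of `G`, as an orbit space. -/
abbrev Hexagon (G : Type*) [CommGroup G] :=
  MulAction.orbitRel.Quotient (G × Equiv.Perm (Fin 3)) (Triple G)

/-- The triple with given coordinates. -/
def Triple.mk {G : Type*} (x y z : G) : Triple G := ![x, y, z]

theorem Triple.smul_mk_eq_iff {G : Type*} [CommGroup G] (g : G) (σ : Equiv.Perm (Fin 3))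
    {a b c x y z : G} : (g, σ) • Triple.mk a b c = Triple.mk x y z ↔
      g * Triple.mk a b c (σ⁻¹ 0) = x ∧ g * Triple.mk a b c (σ⁻¹ 1) = y ∧
        g * Triple.mk a b c (σ⁻¹ 2) = z := by
  rw [Triple.smul_eq_iff]
  constructor
  · exact fun h => ⟨h 0, h 1, h 2⟩
  · rintro ⟨h₀, h₁, h₂⟩ i
    fin_cases i
    exacts [h₀, h₁, h₂]

/-- The hexagon of a triple. -/
def hexagonOf {G : Type*} [CommGroup G] (x y z : G) : Hexagon G :=
  Quotient.mk'' (Triple.mk x y z)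

theorem hexagonOf_surjective {G : Type*} [CommGroup G] (h : Hexagon G) :
    ∃ x y z, hexagonOf x y z = h := by
  induction h using Quotient.inductionOn' with
  | h v =>
    refine ⟨v 0, v 1, v 2, ?_⟩
    have : Triple.mk (v 0) (v 1) (v 2) = v := by
      refine funext fun i => ?_
      fin_cases i <;> rfl
    rw [hexagonOf, this]

theorem hexagonOf_eq_iff {G : Type*} [CommGroup G] {x y z a b c : G} :
    hexagonOf x y z = hexagonOf a b c ↔ ∃ g : G,
      (g * a = x ∧ g * b = y ∧ g * c = z) ∨ (g * b = x ∧ g * a = y ∧ g * c = z) ∨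
      (g * c = x ∧ g * b = y ∧ g * a = z) ∨ (g * a = x ∧ g * c = y ∧ g * b = z) ∨
      (g * c = x ∧ g * a = y ∧ g * b = z) ∨ (g * b = x ∧ g * c = y ∧ g * a = z) := by
  have hperm : ∀ p : Equiv.Perm (Fin 3) → Prop, (∃ σ, p σ) ↔
      p 1 ∨ p (Equiv.swap 0 1) ∨ p (Equiv.swap 0 2) ∨ p (Equiv.swap 1 2) ∨
      p (finRotate 3) ∨ p (finRotate 3)⁻¹ := by
    intro p
    have h : (∃ σ, p σ) ↔ ∃ σ ∈ Finset.univ, p σ := by simp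
    rw [h, univ_perm_fin_three]
    simp only [Finset.exists_mem_insert, Finset.mem_singleton, exists_eq_left]
  rw [hexagonOf, hexagonOf, Quotient.eq'', MulAction.orbitRel_apply, MulAction.mem_orbit_iff,
    Prod.exists]
  refine exists_congr fun g => ?_
  simp only [hperm, Triple.smul_mk_eq_iff]
  rfl

theorem card_fixed_one {G : Type*} [CommGroup G] :
    Nat.card {p : G × Triple G // (p.1, (1 : Equiv.Perm (Fin 3))) • p.2 = p.2} =
      Nat.card G ^ 3 := by
  have e : {p : G × Triple G // (p.1, (1 : Equiv.Perm (Fin 3))) • p.2 = p.2} ≃ (Fin 3 → G) :=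
    { toFun := fun p => p.1.2
      invFun := fun v => ⟨(1, v), (Triple.smul_eq_iff _ _ _).2 fun i => one_mul _⟩
      left_inv := by
        rintro ⟨⟨g, v⟩, h⟩
        have h := (Triple.smul_eq_iff _ _ _).1 h 0
        have : g = 1 := by simpa using h
        subst this; rfl
      right_inv := fun v => rfl }
  rw [Nat.card_congr e, Nat.card_fun]; simp

theorem card_fixed_swap {G : Type*} [CommGroup G] {i j k : Fin 3} (hij : i ≠ j) (hik : i ≠ k)
    (hjk : j ≠ k) :
    Nat.card {p : G × Triple G // (p.1, Equiv.swap i j) • p.2 = p.2} = Nat.card G ^ 2 := by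
  have hall : ∀ l, l = i ∨ l = j ∨ l = k := by lia
  have e : {p : G × Triple G // (p.1, Equiv.swap i j) • p.2 = p.2} ≃ G × G :=
    { toFun := fun p => (p.1.2 i, p.1.2 k)
      invFun := fun v => ⟨(1, fun l => if l = k then v.2 else v.1),
        (Triple.smul_eq_iff _ _ _).2 fun l => by
          rcases hall l with rfl | rfl | rfl <;>
            simp [*, Equiv.swap_apply_of_ne_of_ne, hik.symm, hjk.symm]⟩
      left_inv := by
        rintro ⟨⟨g, v⟩, h⟩
        have h := (Triple.smul_eq_iff _ _ _).1 h
        have hk := h k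
        have hj := h j
        have hg : g = 1 := by
          simpa [Equiv.swap_apply_of_ne_of_ne, hik.symm, hjk.symm] using hk
        subst hg
        have hj : v i = v j := by simpa using hj
        refine Subtype.ext (Prod.ext rfl (funext fun l => ?_))
        rcases hall l with rfl | rfl | rfl <;> simp [*]
      right_inv := fun v => by simp [hik] }
  rw [Nat.card_congr e, Nat.card_prod, sq]

theorem card_fixed_cycle {G : Type*} [CommGroup G] {σ : Equiv.Perm (Fin 3)} {i j k : Fin 3}
    (hij : i ≠ j) (hik : i ≠ k) (hjk : j ≠ k) (hi : σ j = i) (hj : σ k = j) (hk : σ i = k) :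
    Nat.card {p : G × Triple G // (p.1, σ) • p.2 = p.2} =
      Nat.card G * Nat.card {x : G // x ^ 3 = 1} := by
  have hall : ∀ l, l = i ∨ l = j ∨ l = k := by lia
  have hi' : σ⁻¹ i = j := by rw [← hi]; simp
  have hj' : σ⁻¹ j = k := by rw [← hj]; simp
  have hk' : σ⁻¹ k = i := by rw [← hk]; simp
  have key : ∀ g : G, ∀ v : Triple G, (g, σ) • v = v ↔
      g ^ 3 = 1 ∧ v k = g * v i ∧ v j = g ^ 2 * v i := by
    intro g v
    rw [Triple.smul_eq_iff]
    constructor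
    · intro h
      have h₁ := h i
      have h₂ := h j
      have h₃ := h k
      simp only [hi', hj', hk'] at h₁ h₂ h₃
      refine ⟨?_, h₃.symm, ?_⟩
      · rw [← h₂, ← h₃] at h₁
        exact mul_right_cancel (b := v i) (by rw [pow_three, mul_assoc, mul_assoc, h₁, one_mul])
      · rw [← h₂, ← h₃, sq, mul_assoc]
    · rintro ⟨h₁, h₂, h₃⟩ l
      rcases hall l with rfl | rfl | rfl
      · simp only [hi', h₃]
        rw [← mul_assoc, ← pow_succ', h₁, one_mul]
      · simp only [hj', h₂, h₃]
        rw [← mul_assoc, sq]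
      · simp only [hk', h₂]
  have e : {p : G × Triple G // (p.1, σ) • p.2 = p.2} ≃ G × {x : G // x ^ 3 = 1} :=
    { toFun := fun p => (p.1.2 i, ⟨p.1.1, ((key _ _).1 p.2).1⟩)
      invFun := fun v => ⟨(v.2, fun l => if l = i then v.1 else if l = k then v.2 * v.1 else
          v.2 ^ 2 * v.1), (key _ _).2 (by simp [v.2.2, hik.symm, hij.symm, hjk])⟩
      left_inv := by
        rintro ⟨⟨g, v⟩, h⟩
        obtain ⟨_, h₁, h₂⟩ := (key _ _).1 h
        refine Subtype.ext (Prod.ext rfl (funext fun l => ?_))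
        dsimp only at h₁ h₂ ⊢
        rcases hall l with rfl | rfl | rfl
        · simp
        · simp [h₂, hij.symm, hjk]
        · simp [h₁, hik.symm]
      right_inv := fun v => by simp }
  rw [Nat.card_congr e, Nat.card_prod]

theorem six_mul_card_hexagon (G : Type*) [CommGroup G] [Fintype G] :
    6 * Nat.card (Hexagon G) =
      Fintype.card G ^ 2 + 3 * Fintype.card G + 2 * Nat.card {x : G // x ^ 3 = 1} := by
  classical
  have h := MulAction.sum_card_fixedBy_eq_card_orbits_mul_card_group
    (G × Equiv.Perm (Fin 3)) (Triple G)
  have hσ : ∀ σ : Equiv.Perm (Fin 3),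
      ∑ g : G, Fintype.card (MulAction.fixedBy (Triple G) (g, σ)) =
        Nat.card {p : G × Triple G // (p.1, σ) • p.2 = p.2} := by
    intro σ
    rw [← Fintype.card_sigma, ← Nat.card_eq_fintype_card]
    exact Nat.card_congr (Equiv.subtypeProdEquivSigmaSubtype
      (fun (g : G) (v : Triple G) => (g, σ) • v = v)).symm
  rw [Fintype.sum_prod_type_right, Finset.sum_congr rfl fun σ _ => hσ σ, univ_perm_fin_three,
    Finset.sum_insert (by decide), Finset.sum_insert (by decide), Finset.sum_insert (by decide),
    Finset.sum_insert (by decide), Finset.sum_insert (by decide), Finset.sum_singleton,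
    card_fixed_one, card_fixed_swap (k := 2) (by decide) (by decide) (by decide),
    card_fixed_swap (k := 1) (by decide) (by decide) (by decide),
    card_fixed_swap (k := 0) (by decide) (by decide) (by decide),
    card_fixed_cycle (σ := finRotate 3) (i := 1) (j := 0) (k := 2) (by decide) (by decide)
      (by decide) (by decide) (by decide) (by decide),
    card_fixed_cycle (σ := (finRotate 3)⁻¹) (i := 1) (j := 2) (k := 0) (by decide) (by decide)
      (by decide) (by decide) (by decide) (by decide), Fintype.card_prod, Fintype.card_perm,
    ← Nat.card_eq_fintype_card (α := Quotient _)] at h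
  simp only [Fintype.card_fin, Nat.card_eq_fintype_card (α := G)] at h
  have h6 : Nat.factorial 3 = 6 := rfl
  rw [h6] at h
  have hn : 0 < Fintype.card G := Fintype.card_pos
  refine Nat.eq_of_mul_eq_mul_right hn ?_
  calc _ = _ := by rw [mul_comm, mul_comm 6, mul_left_comm, mul_comm]
    _ = _ := h.symm
    _ = _ := by ring


section Hexagons

variable {G : Type*} [CommGroup G]

theorem hexagonOf_swap (x y z : G) : hexagonOf y x z = hexagonOf x y z :=
  hexagonOf_eq_iff.2 ⟨1, by simp⟩

theorem hexagonOf_rotate (x y z : G) : hexagonOf y z x = hexagonOf x y z :=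
  hexagonOf_eq_iff.2 ⟨1, by simp⟩

theorem hexagonOf_mul (g x y z : G) : hexagonOf (g * x) (g * y) (g * z) = hexagonOf x y z :=
  hexagonOf_eq_iff.2 ⟨g, by simp⟩

/-- The set of all triples lying in one of the given hexagons. -/
def hexagonUnion (T : Finset (Hexagon G)) : Set (G × G × G) :=
  {v | hexagonOf v.1 v.2.1 v.2.2 ∈ T}

theorem mem_hexagonUnion {T : Finset (Hexagon G)} {x y z : G} :
    (x, y, z) ∈ hexagonUnion T ↔ hexagonOf x y z ∈ T := Iff.rfl

theorem isSymmetric_hexagonUnion (T : Finset (Hexagon G)) : IsSymmetric (hexagonUnion T) := by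
  refine ⟨fun x y z h => ?_, fun x y z h => ?_, fun g x y z h => ?_⟩ <;>
    rw [mem_hexagonUnion] at h ⊢
  · rwa [hexagonOf_swap]
  · rwa [hexagonOf_rotate]
  · rwa [hexagonOf_mul]

theorem hexagonUnion_injective :
    Function.Injective (hexagonUnion : Finset (Hexagon G) → Set (G × G × G)) := by
  intro T T' h
  ext a
  obtain ⟨x, y, z, rfl⟩ := hexagonOf_surjective a
  rw [← mem_hexagonUnion, h, mem_hexagonUnion]

theorem IsSymmetric.mem_of_hexagonOf_eq {S : Set (G × G × G)} (hS : IsSymmetric S)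
    {x y z a b c : G} (h : hexagonOf a b c = hexagonOf x y z) (hx : (x, y, z) ∈ S) :
    (a, b, c) ∈ S := by
  obtain ⟨hswap, hrot, hmul⟩ := hS
  obtain ⟨g, h⟩ := hexagonOf_eq_iff.1 h
  have h₁ := hmul g _ _ _ hx
  have h₂ := hswap _ _ _ h₁
  rcases h with ⟨rfl, rfl, rfl⟩ | ⟨rfl, rfl, rfl⟩ | ⟨rfl, rfl, rfl⟩ | ⟨rfl, rfl, rfl⟩ |
    ⟨rfl, rfl, rfl⟩ | ⟨rfl, rfl, rfl⟩
  · exact h₁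
  · exact h₂
  · exact hrot _ _ _ (hrot _ _ _ h₂)
  · exact hrot _ _ _ h₂
  · exact hrot _ _ _ (hrot _ _ _ h₁)
  · exact hrot _ _ _ h₁

open scoped Classical in
theorem IsSymmetric.exists_hexagonUnion_eq [Fintype G] {S : Set (G × G × G)}
    (hS : IsSymmetric S) : ∃ T : Finset (Hexagon G), hexagonUnion T = S := by
  refine ⟨Finset.univ.filter fun a => ∃ x y z, hexagonOf x y z = a ∧ (x, y, z) ∈ S, ?_⟩
  ext ⟨x, y, z⟩
  simp only [mem_hexagonUnion, Finset.mem_filter, Finset.mem_univ, true_and]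
  constructor
  · rintro ⟨a, b, c, h, hS'⟩
    exact hS.mem_of_hexagonOf_eq h.symm hS'
  · exact fun h => ⟨x, y, z, rfl, h⟩

/-- The hexagon of the triple `(x, y, 1)`. -/
def hexagonPair (p : G × G) : Hexagon G := hexagonOf p.1 p.2 1

open scoped Classical in
theorem card_filter_hexagonPair_eq_le {ι : Type*} {u : ι → G × G} (hu : Function.Injective u)
    (T : Finset ι) (a : Hexagon G) : (T.filter fun i => hexagonPair (u i) = a).card ≤ 6 := by
  obtain ⟨x, y, z, rfl⟩ := hexagonOf_surjective a
  refine (Finset.card_le_card_of_injOn u (t := {(z⁻¹ * x, z⁻¹ * y), (z⁻¹ * y, z⁻¹ * x),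
    (x⁻¹ * z, x⁻¹ * y), (y⁻¹ * x, y⁻¹ * z), (y⁻¹ * z, y⁻¹ * x), (x⁻¹ * y, x⁻¹ * z)}) ?_
    hu.injOn).trans Finset.card_le_six
  intro i hi
  obtain ⟨g, h⟩ := hexagonOf_eq_iff.1 (Finset.mem_filter.1 hi).2
  simp only [mul_eq_one_iff_eq_inv] at h
  simp only [Finset.coe_insert, Finset.coe_singleton, Set.mem_insert_iff,
    Set.mem_singleton_iff, Prod.ext_iff]
  rcases h with ⟨h, h', rfl⟩ | ⟨h, h', rfl⟩ | ⟨h, h', rfl⟩ | ⟨h, h', rfl⟩ | ⟨h, h', rfl⟩ |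
    ⟨h, h', rfl⟩ <;> simp [h, h']

open scoped Classical in
theorem four_pow_mul_card_avoiding_hexagons_le [Fintype G] {ι : Type*} {u v : ι → G × G}
    (hu : Function.Injective u) (hv : Function.Injective v) {F : ι → Finset (Hexagon G)}
    (hF : ∀ i, F i ⊆ {hexagonPair (u i), hexagonPair (v i)}) {T : Finset ι} {k : ℕ}
    (hk : 24 * k ≤ T.card) {B : Finset (Finset (Hexagon G))}
    (hB : ∀ S ∈ B, ∀ i ∈ T, S ∩ {hexagonPair (u i), hexagonPair (v i)} ≠ F i) :
    4 ^ k * B.card ≤ 3 ^ k * 2 ^ Nat.card (Hexagon G) := by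
  rw [Nat.card_eq_fintype_card]
  refine (Nat.mul_le_mul_left _ (Finset.card_le_card fun S hS => ?_)).trans
    (four_pow_mul_card_forall_inter_ne_le hF (fun i => Finset.card_le_two)
      (K := 12) (by norm_num) k T ?_ hk)
  · exact Finset.mem_filter.2 ⟨Finset.mem_univ _, hB S hS⟩
  · intro a
    calc _ ≤ ((T.filter fun i => hexagonPair (u i) = a) ∪
            (T.filter fun i => hexagonPair (v i) = a)).card := by
          refine Finset.card_le_card fun i hi => ?_
          simp only [Finset.mem_filter, Finset.mem_insert, Finset.mem_singleton,
            Finset.mem_union] at hi ⊢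
          rcases hi with ⟨hi, rfl | rfl⟩ <;> simp [hi]
      _ ≤ 6 + 6 := (Finset.card_union_le _ _).trans (Nat.add_le_add
          (card_filter_hexagonPair_eq_le hu T a) (card_filter_hexagonPair_eq_le hv T a))

open scoped Classical in
/-- The sets of hexagons whose union is not hyperfield-defining with respect to `ε`. -/
noncomputable def badHexagonSets [Fintype G] (ε : G) : Finset (Finset (Hexagon G)) :=
  Finset.univ.filter fun T => ¬(CondA ε (hexagonUnion T) ∧ CondB ε (hexagonUnion T))

theorem mem_badHexagonSets [Fintype G] {ε : G} {T : Finset (Hexagon G)} :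
    T ∈ badHexagonSets ε ↔ ¬(CondA ε (hexagonUnion T) ∧ CondB ε (hexagonUnion T)) := by
  simp [badHexagonSets]

open scoped Classical in
theorem four_pow_mul_card_badHexagonSets_le [Fintype G] (ε : G) {k : ℕ}
    (hk : 24 * k ≤ Fintype.card G) :
    4 ^ k * (badHexagonSets ε).card ≤ (Fintype.card G + Fintype.card G ^ 4) *
      (3 ^ k * 2 ^ Nat.card (Hexagon G)) := by
  set BA : G → Finset (Finset (Hexagon G)) := fun x =>
    Finset.univ.filter fun T => ∀ y, hexagonPair (x, y) ∉ T with hBA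
  set BB : G × G × G × G → Finset (Finset (Hexagon G)) := fun q =>
    Finset.univ.filter fun T => ∀ t, ¬(hexagonPair (t * q.1, ε * t * q.2.2.1) ∈ T ∧
      hexagonPair (ε * t * q.2.1, t * q.2.2.2) ∈ T) with hBB
  have hBA' : ∀ x, 4 ^ k * (BA x).card ≤ 3 ^ k * 2 ^ Nat.card (Hexagon G) := by
    intro x
    refine four_pow_mul_card_avoiding_hexagons_le (ι := G) (u := fun y => (x, y))
      (v := fun y => (x, y)) (Prod.mk_right_injective x) (Prod.mk_right_injective x)
      (F := fun y => {hexagonPair (x, y), hexagonPair (x, y)}) (fun i => subset_rfl)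
      (T := Finset.univ) (by simpa using hk) fun S hS y _ h => ?_
    refine (Finset.mem_filter.1 hS).2 y (Finset.inter_eq_right.1 h ?_)
    simp
  have hBB' : ∀ q, 4 ^ k * (BB q).card ≤ 3 ^ k * 2 ^ Nat.card (Hexagon G) := by
    intro q
    refine four_pow_mul_card_avoiding_hexagons_le (ι := G)
      (u := fun t => (t * q.1, ε * t * q.2.2.1)) (v := fun t => (ε * t * q.2.1, t * q.2.2.2))
      (fun s t h => mul_right_cancel (Prod.ext_iff.1 h).1)
      (fun s t h => mul_right_cancel (Prod.ext_iff.1 h).2)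
      (F := fun t => {hexagonPair (t * q.1, ε * t * q.2.2.1),
        hexagonPair (ε * t * q.2.1, t * q.2.2.2)}) (fun i => subset_rfl)
      (T := Finset.univ) (by simpa using hk) fun S hS t _ h => ?_
    have h := Finset.inter_eq_right.1 h
    exact (Finset.mem_filter.1 hS).2 t ⟨h (by simp), h (by simp)⟩
  have hsub : badHexagonSets ε ⊆ Finset.univ.biUnion BA ∪ Finset.univ.biUnion BB := by
    intro T hT
    rw [mem_badHexagonSets, not_and_or] at hT
    simp only [Finset.mem_union, Finset.mem_biUnion, Finset.mem_univ, true_and, hBA, hBB,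
      Finset.mem_filter]
    refine hT.imp (fun h => ?_) fun h => ?_
    · simp only [CondA, not_forall, not_exists] at h
      obtain ⟨x, _, hx⟩ := h
      exact ⟨x, hx⟩
    · simp only [CondB, not_forall, not_exists] at h
      obtain ⟨x, y, z, w, _, _, _, h⟩ := h
      exact ⟨(x, y, z, w), h⟩
  calc 4 ^ k * (badHexagonSets ε).card
      ≤ 4 ^ k * (∑ x, (BA x).card + ∑ q, (BB q).card) := by
        gcongr
        exact (Finset.card_le_card hsub).trans ((Finset.card_union_le _ _).trans
          (Nat.add_le_add Finset.card_biUnion_le Finset.card_biUnion_le))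
    _ = ∑ x, 4 ^ k * (BA x).card + ∑ q, 4 ^ k * (BB q).card := by
        rw [mul_add, Finset.mul_sum, Finset.mul_sum]
    _ ≤ ∑ _x : G, 3 ^ k * 2 ^ Nat.card (Hexagon G) +
          ∑ _q : G × G × G × G, 3 ^ k * 2 ^ Nat.card (Hexagon G) := by
        exact Nat.add_le_add (Finset.sum_le_sum fun x _ => hBA' x)
          (Finset.sum_le_sum fun q _ => hBB' q)
    _ = _ := by
        simp only [Finset.sum_const, Finset.card_univ, Fintype.card_prod, smul_eq_mul]
        ring

open scoped Classical in
theorem two_pow_card_hexagon_le [Fintype G] (ε : G) (hG : 1 < Fintype.card G) :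
    2 ^ Nat.card (Hexagon G) ≤ 2 ^ Fintype.card G * (badHexagonSets ε).card := by
  have : Nontrivial G := Fintype.one_lt_card_iff_nontrivial.1 hG
  obtain ⟨x, hx⟩ := exists_ne ε
  set I : Finset (Hexagon G) := Finset.univ.image fun y => hexagonPair (x, y)
  have hI : I.card ≤ Fintype.card G := Finset.card_image_le
  have hsub : Iᶜ.powerset ⊆ badHexagonSets ε := by
    intro T hT
    rw [mem_badHexagonSets]
    rintro ⟨hA, -⟩
    obtain ⟨y, hy⟩ := hA x hx
    exact Finset.mem_compl.1 (Finset.mem_powerset.1 hT hy)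
      (Finset.mem_image_of_mem _ (Finset.mem_univ y))
  calc 2 ^ Nat.card (Hexagon G) = 2 ^ I.card * 2 ^ Iᶜ.card := by
        rw [← pow_add, Finset.card_add_card_compl, Nat.card_eq_fintype_card]
    _ ≤ 2 ^ Fintype.card G * (badHexagonSets ε).card := by
        rw [← Finset.card_powerset Iᶜ]
        gcongr
        norm_num

open scoped Classical in
theorem four_mul_card_hexagonPair_map_eq_le [Fintype G] {f : G ≃* G} (hf : f ≠ 1) :
    4 * (Finset.univ.filter fun p : G × G =>
      hexagonPair (f p.1, f p.2) = hexagonPair p).card ≤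
      Fintype.card G ^ 2 + 20 * Fintype.card G := by
  set A : Finset G := Finset.univ.filter fun x => f x = x
  have hA : 2 * A.card ≤ Fintype.card G := by
    set K : Subgroup G := f.toMonoidHom.eqLocus (MonoidHom.id G)
    have hK : Nat.card K = A.card := by
      rw [Nat.card_eq_fintype_card, Fintype.card_subtype]
      rfl
    have hindex : K.index ≠ 1 := by
      rw [Ne, Subgroup.index_eq_one]
      intro h
      refine hf (MulEquiv.ext fun x => ?_)
      have : x ∈ K := h ▸ Subgroup.mem_top x
      exact this
    have hmul := K.card_mul_index
    have hpos : K.index ≠ 0 := Subgroup.index_ne_zero_of_finite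
    rw [hK, Nat.card_eq_fintype_card] at hmul
    have : 2 ≤ K.index := by lia
    nlinarith
  have hsub : (Finset.univ.filter fun p : G × G =>
      hexagonPair (f p.1, f p.2) = hexagonPair p) ⊆ A ×ˢ A ∪
      (Finset.univ.image (fun x => (x, f x)) ∪ (Finset.univ.image (fun y => (y * (f y)⁻¹, y)) ∪
      (Finset.univ.image (fun x => (x, x * (f x)⁻¹)) ∪
      (Finset.univ.image (fun x => (x, (f x)⁻¹)) ∪
      Finset.univ.image (fun y => ((f y)⁻¹, y)))))) := by
    rintro ⟨x, y⟩ hp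
    obtain ⟨g, h⟩ := hexagonOf_eq_iff.1 (Finset.mem_filter.1 hp).2
    simp only [Finset.mem_union, Finset.mem_product, Finset.mem_image, Finset.mem_univ,
      true_and, Prod.mk.injEq, A, Finset.mem_filter]
    dsimp only at h
    rcases h with ⟨h₁, h₂, h₃⟩ | ⟨h₁, h₂, h₃⟩ | ⟨h₁, h₂, h₃⟩ | ⟨h₁, h₂, h₃⟩ | ⟨h₁, h₂, h₃⟩ |
      ⟨h₁, h₂, h₃⟩
    · left
      rw [mul_one] at h₃
      simp [h₃] at h₁ h₂
      exact ⟨h₁.symm, h₂.symm⟩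
    · right; left
      rw [mul_one] at h₃
      rw [h₃, one_mul] at h₁
      exact ⟨x, rfl, h₁.symm⟩
    · right; right; left
      rw [← eq_inv_iff_mul_eq_one] at h₃
      exact ⟨y, by rw [← h₂, h₃]; group, rfl⟩
    · right; right; right; left
      rw [← eq_inv_iff_mul_eq_one] at h₃
      exact ⟨x, rfl, by rw [← h₁, h₃]; group⟩
    · right; right; right; right; left
      rw [← eq_inv_iff_mul_eq_one] at h₃
      exact ⟨x, rfl, by rw [← h₁, h₃]; group⟩
    · right; right; right; right; right
      rw [← eq_inv_iff_mul_eq_one] at h₃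
      exact ⟨y, by rw [← h₂, h₃]; group, rfl⟩
  have himage : ∀ u : G → G × G, (Finset.univ.image u).card ≤ Fintype.card G := fun u =>
    Finset.card_image_le
  have hcard : (Finset.univ.filter fun p : G × G =>
      hexagonPair (f p.1, f p.2) = hexagonPair p).card ≤
      A.card * A.card + (Fintype.card G + (Fintype.card G + (Fintype.card G +
        (Fintype.card G + Fintype.card G)))) := by
    refine (Finset.card_le_card hsub).trans ((Finset.card_union_le _ _).trans
      (Nat.add_le_add (Finset.card_product _ _).le ?_))
    iterate 4
      refine (Finset.card_union_le _ _).trans (Nat.add_le_add (himage _) ?_)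
    exact himage _
  nlinarith

open scoped Classical in
theorem four_pow_mul_card_invariant_le [Fintype G] {f : G ≃* G} (hf : f ≠ 1)
    (hG : 20 ≤ Fintype.card G) {k : ℕ} (hk : 48 * k ≤ Fintype.card G ^ 2)
    {B : Finset (Finset (Hexagon G))}
    (hB : ∀ S ∈ B, ∀ p, hexagonPair p ∈ S → hexagonPair (f p.1, f p.2) ∈ S) :
    4 ^ k * B.card ≤ 3 ^ k * 2 ^ Nat.card (Hexagon G) := by
  have hcard := Finset.card_filter_add_card_filter_not (s := (Finset.univ : Finset (G × G)))
    (fun p => hexagonPair (f p.1, f p.2) = hexagonPair p)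
  have hle := four_mul_card_hexagonPair_map_eq_le hf
  rw [Finset.card_univ, Fintype.card_prod] at hcard
  refine four_pow_mul_card_avoiding_hexagons_le (ι := G × G) (u := fun p => p)
    (v := fun p => (f p.1, f p.2)) Function.injective_id
    (fun p q h => Prod.ext (f.injective (Prod.ext_iff.1 h).1) (f.injective (Prod.ext_iff.1 h).2))
    (F := fun p => {hexagonPair p}) (fun p => by simp)
    (T := Finset.univ.filter fun p => ¬ hexagonPair (f p.1, f p.2) = hexagonPair p)
    (by nlinarith) fun S hS p hp h => ?_
  have hp := (Finset.mem_filter.1 hp).2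
  have h₁ : hexagonPair p ∈ S :=
    (Finset.mem_inter.1 (h.symm ▸ Finset.mem_singleton_self (hexagonPair p))).1
  have h₂ : hexagonPair (f p.1, f p.2) ∈ ({hexagonPair p} : Finset (Hexagon G)) := by
    rw [← h]
    simp [hB S hS p h₁]
  exact hp (Finset.mem_singleton.1 h₂)

end Hexagons


section Pairs

variable {G : Type*} [CommGroup G]

/-- The pairs `(ε, S)` with `ε² = 1` and `S` symmetric and hyperfield-defining w.r.t. `ε`. -/
abbrev HFPair (G : Type*) [CommGroup G] :=
  {p : G × Set (G × G × G) // p.1 ^ 2 = 1 ∧ IsSymmetric p.2 ∧ CondA p.1 p.2 ∧ CondB p.1 p.2}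

theorem mem_tripleMap_image (f : G ≃* G) {S : Set (G × G × G)} {x y z : G} :
    (x, y, z) ∈ tripleMap f '' S ↔ (f.symm x, f.symm y, f.symm z) ∈ S := by
  constructor
  · rintro ⟨⟨a, b, c⟩, h, h'⟩
    simp only [tripleMap, Prod.mk.injEq] at h'
    obtain ⟨rfl, rfl, rfl⟩ := h'
    simpa using h
  · exact fun h => ⟨_, h, by simp [tripleMap]⟩

theorem IsSymmetric.image {S : Set (G × G × G)} (hS : IsSymmetric S) (f : G ≃* G) :
    IsSymmetric (tripleMap f '' S) := by
  obtain ⟨h₁, h₂, h₃⟩ := hS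
  refine ⟨fun x y z h => ?_, fun x y z h => ?_, fun g x y z h => ?_⟩ <;>
    rw [mem_tripleMap_image] at h ⊢
  · exact h₁ _ _ _ h
  · exact h₂ _ _ _ h
  · simpa using h₃ (f.symm g) _ _ _ h

theorem CondA.image {ε : G} {S : Set (G × G × G)} (hS : CondA ε S) (f : G ≃* G) :
    CondA (f ε) (tripleMap f '' S) := by
  intro x hx
  obtain ⟨y, hy⟩ := hS (f.symm x) (fun h => hx (by rw [← h]; simp))
  exact ⟨f y, by rw [mem_tripleMap_image]; simpa using hy⟩

theorem CondB.image {ε : G} {S : Set (G × G × G)} (hS : CondB ε S) (f : G ≃* G) :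
    CondB (f ε) (tripleMap f '' S) := by
  intro x y z w hxy hzw hne
  rw [mem_tripleMap_image, map_one] at hxy hzw
  obtain ⟨t, ht, ht'⟩ := hS _ _ _ _ hxy hzw (by simpa using hne)
  exact ⟨f t, by rw [mem_tripleMap_image]; simpa using ht,
    by rw [mem_tripleMap_image]; simpa using ht'⟩

instance : MulAction (MulAut G) (HFPair G) where
  smul f p := ⟨(f p.1.1, tripleMap f '' p.1.2), by
    obtain ⟨h₁, h₂, h₃, h₄⟩ := p.2
    exact ⟨by rw [← map_pow, h₁, map_one], h₂.image f, h₃.image f, h₄.image f⟩⟩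
  one_smul p := Subtype.ext (Prod.ext rfl (by
    change tripleMap (1 : MulAut G) '' p.1.2 = p.1.2
    exact Set.image_id _))
  mul_smul f g p := Subtype.ext (Prod.ext rfl (by
    change tripleMap (f * g : MulAut G) '' p.1.2 = tripleMap f '' (tripleMap g '' p.1.2)
    rw [Set.image_image]
    rfl))

theorem numHFClasses_eq_card_quotient (G : Type*) [CommGroup G] :
    numHFClasses G = Nat.card (MulAction.orbitRel.Quotient (MulAut G) (HFPair G)) := by
  have h : ∀ p q : HFPair G,
      hfPairRel G p q ↔ (MulAction.orbitRel (MulAut G) (HFPair G)) q p := by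
    intro p q
    rw [MulAction.orbitRel_apply, MulAction.mem_orbit_iff]
    refine exists_congr fun f => ?_
    rw [Subtype.ext_iff, Prod.ext_iff]
    rfl
  refine Nat.card_congr (Quot.congr (Equiv.refl _) fun p q => ?_)
  rw [h]
  exact ⟨fun h => Setoid.symm' _ h, fun h => Setoid.symm' _ h⟩

/-- A hyperfield-defining pair is a square root of unity together with a set of hexagons that is
not bad for it. -/
noncomputable def goodEquivHFPair (G : Type*) [CommGroup G] [Fintype G] :
    (Σ ε : {x : G // x ^ 2 = 1}, {T : Finset (Hexagon G) // T ∉ badHexagonSets ε.1}) ≃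
      HFPair G :=
  Equiv.ofBijective
    (fun s => ⟨(s.1.1, hexagonUnion s.2.1), s.1.2, isSymmetric_hexagonUnion _,
      not_not.1 (mt mem_badHexagonSets.2 s.2.2)⟩) (by
    constructor
    · rintro ⟨⟨ε, hε⟩, T, hT⟩ ⟨⟨ε', hε'⟩, T', hT'⟩ h
      simp only [Subtype.mk.injEq, Prod.mk.injEq] at h
      obtain ⟨rfl, h⟩ := h
      obtain rfl := hexagonUnion_injective h
      rfl
    · rintro ⟨⟨ε, S⟩, hε, hS, hAB⟩
      obtain ⟨T, rfl⟩ := hS.exists_hexagonUnion_eq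
      exact ⟨⟨⟨ε, hε⟩, T, fun h => mem_badHexagonSets.1 h hAB⟩, rfl⟩)

open scoped Classical in
theorem card_hfPair_add_sum_card_bad [Fintype G] :
    Nat.card (HFPair G) + ∑ ε : {x : G // x ^ 2 = 1}, (badHexagonSets ε.1).card =
      Nat.card {x : G // x ^ 2 = 1} * 2 ^ Nat.card (Hexagon G) := by
  have h : ∀ ε : G, Fintype.card {T : Finset (Hexagon G) // T ∉ badHexagonSets ε} +
      (badHexagonSets ε).card = 2 ^ Nat.card (Hexagon G) := by
    intro ε
    rw [Fintype.card_subtype, Nat.card_eq_fintype_card, ← Fintype.card_finset,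
      ← Finset.card_univ, ← Finset.card_filter_add_card_filter_not (s := Finset.univ)
        (fun T => T ∈ badHexagonSets ε), add_comm]
    simp
  rw [← Nat.card_congr (goodEquivHFPair G), Nat.card_eq_fintype_card, Fintype.card_sigma,
    ← Finset.sum_add_distrib, Finset.sum_congr rfl fun ε _ => h ε.1]
  simp [Nat.card_eq_fintype_card]

theorem card_mulAut_le (G : Type*) [CommGroup G] [Fintype G] :
    Nat.card (MulAut G) ≤ Fintype.card G ^ Fintype.card G := by
  have := Nat.card_le_card_of_injective (fun f : MulAut G => (f : G → G)) DFunLike.coe_injective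
  simpa [Nat.card_fun, Nat.card_eq_fintype_card] using this

open scoped Classical in
theorem four_pow_mul_card_fixedBy_le [Fintype G] {f : MulAut G} (hf : f ≠ 1)
    (hG : 20 ≤ Fintype.card G) {k : ℕ} (hk : 48 * k ≤ Fintype.card G ^ 2) :
    4 ^ k * Nat.card (MulAction.fixedBy (HFPair G) f) ≤
      Nat.card {x : G // x ^ 2 = 1} * (3 ^ k * 2 ^ Nat.card (Hexagon G)) := by
  set B : Finset (Finset (Hexagon G)) := Finset.univ.filter fun S =>
    ∀ p, hexagonPair p ∈ S → hexagonPair (f p.1, f p.2) ∈ S with hB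
  have hBcard := four_pow_mul_card_invariant_le hf hG hk (B := B)
    fun S hS => (Finset.mem_filter.1 hS).2
  have hinj : Nat.card (MulAction.fixedBy (HFPair G) f) ≤
      Nat.card ({x : G // x ^ 2 = 1} × B) := by
    have hT : ∀ p : HFPair G, ∃ T, hexagonUnion T = p.1.2 := fun p =>
      p.2.2.1.exists_hexagonUnion_eq
    choose T hT using hT
    refine Nat.card_le_card_of_injective
      (fun p => (⟨p.1.1.1, p.1.2.1⟩, ⟨T p.1, Finset.mem_filter.2 ⟨Finset.mem_univ _, ?_⟩⟩)) ?_
    · rintro ⟨x, y⟩ h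
      have hfix : tripleMap f '' p.1.1.2 = p.1.1.2 :=
        (Prod.ext_iff.1 (Subtype.ext_iff.1 p.2)).2
      change (x, y, 1) ∈ hexagonUnion _ at h
      change (f x, f y, 1) ∈ hexagonUnion _
      rw [hT] at h ⊢
      rw [← hfix]
      exact ⟨_, h, by simp [tripleMap]⟩
    · intro p q h
      simp only [Prod.mk.injEq, Subtype.mk.injEq] at h
      refine Subtype.ext (Subtype.ext (Prod.ext h.1 ?_))
      rw [← hT, ← hT, h.2]
  rw [Nat.card_prod, Nat.card_eq_fintype_card (α := B), Fintype.card_coe] at hinj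
  calc _ ≤ 4 ^ k * (Nat.card {x : G // x ^ 2 = 1} * B.card) := by gcongr
    _ = Nat.card {x : G // x ^ 2 = 1} * (4 ^ k * B.card) := by ring
    _ ≤ _ := by gcongr

open scoped Classical in
theorem numHFClasses_mul_card_eq (G : Type*) [CommGroup G] [Fintype G] :
    numHFClasses G * Nat.card (MulAut G) = Nat.card (HFPair G) +
      ∑ f ∈ Finset.univ.erase (1 : MulAut G), Nat.card (MulAction.fixedBy (HFPair G) f) := by
  have : Fintype (HFPair G) := Fintype.ofFinite _
  have h := MulAction.sum_card_fixedBy_eq_card_orbits_mul_card_group (MulAut G) (HFPair G)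
  rw [numHFClasses_eq_card_quotient, Nat.card_eq_fintype_card, Nat.card_eq_fintype_card, ← h,
    ← Finset.add_sum_erase _ _ (Finset.mem_univ (1 : MulAut G))]
  congr 1
  · rw [← Nat.card_eq_fintype_card]
    refine Nat.card_congr ((Equiv.setCongr ?_).trans (Equiv.Set.univ _))
    simp
  · exact Finset.sum_congr rfl fun f _ => Nat.card_eq_fintype_card.symm

theorem card_hfPair_le (G : Type*) [CommGroup G] [Fintype G] :
    Nat.card (HFPair G) ≤ numHFClasses G * Nat.card (MulAut G) := by
  classical
  rw [numHFClasses_mul_card_eq]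
  exact Nat.le_add_right _ _

theorem four_pow_mul_numHFClasses_le [Fintype G] (hG : 20 ≤ Fintype.card G) {k : ℕ}
    (hk : 48 * k ≤ Fintype.card G ^ 2) :
    4 ^ k * (numHFClasses G * Nat.card (MulAut G)) ≤ 4 ^ k * Nat.card (HFPair G) +
      Fintype.card G ^ Fintype.card G *
        (Nat.card {x : G // x ^ 2 = 1} * (3 ^ k * 2 ^ Nat.card (Hexagon G))) := by
  classical
  rw [numHFClasses_mul_card_eq, mul_add, Finset.mul_sum]
  gcongr
  refine (Finset.sum_le_card_nsmul _ _ _ fun f hf =>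
    four_pow_mul_card_fixedBy_le (Finset.ne_of_mem_erase hf) hG hk).trans ?_
  rw [smul_eq_mul]
  gcongr
  refine (Finset.card_le_card (Finset.erase_subset _ _)).trans ?_
  rw [Finset.card_univ, ← Nat.card_eq_fintype_card]
  exact card_mulAut_le G

end Pairs

section Asymptotics

open Filter Topology

theorem eventually_poly_mul_le_exp : ∀ᶠ n : ℕ in atTop,
    ((n : ℝ) + n ^ 4) * 3 ^ (n / 24) ≤ 4 ^ (n / 24) * Real.exp (-(1 / 240 * n)) := by
  have hlim : Tendsto (fun m : ℕ => 2 * 24 ^ 4 * (4 / 3) * ((m : ℝ) ^ 4 * (5 / 6) ^ m)) atTop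
      (𝓝 0) := by
    simpa using (tendsto_pow_const_mul_const_pow_of_abs_lt_one 4
      (r := (5 / 6 : ℝ)) (by rw [abs_of_pos] <;> norm_num)).const_mul
        (2 * 24 ^ 4 * (4 / 3) : ℝ)
  have hdiv : Tendsto (fun n : ℕ => n / 24 + 1) atTop atTop :=
    (tendsto_add_atTop_nat 1).comp (Nat.tendsto_div_const_atTop (by norm_num))
  filter_upwards [hdiv.eventually (hlim.eventually_le_const zero_lt_one),
    eventually_ge_atTop 1] with n hn hn1
  set q := n / 24 with hq
  have hnq : (n : ℝ) ≤ 24 * ((q + 1 : ℕ) : ℝ) := by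
    have : n ≤ 24 * (q + 1) := by lia
    exact_mod_cast this
  have hn1' : (1 : ℝ) ≤ n := by exact_mod_cast hn1
  have hexp : Real.exp (1 / 240 * n) ≤ (10 / 9) ^ (q + 1) := by
    calc Real.exp (1 / 240 * n) ≤ Real.exp ((q + 1 : ℕ) * (1 / 10)) := by
          exact Real.exp_le_exp.2 (by linarith)
      _ = Real.exp (1 / 10) ^ (q + 1) := Real.exp_nat_mul _ _
      _ ≤ (10 / 9) ^ (q + 1) := by
          gcongr
          have := Real.one_sub_le_exp_neg (1 / 10)
          rw [Real.exp_neg] at this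
          have hpos := Real.exp_pos (1 / 10)
          rw [le_inv_comm₀ (by norm_num) hpos] at this
          norm_num at this ⊢
          exact this
  have hpoly : (n : ℝ) + n ^ 4 ≤ 2 * 24 ^ 4 * ((q + 1 : ℕ) : ℝ) ^ 4 := by
    calc (n : ℝ) + n ^ 4 ≤ 2 * (n : ℝ) ^ 4 := by
          linarith [le_self_pow₀ hn1' (n := 4) (by norm_num)]
      _ ≤ 2 * (24 * ((q + 1 : ℕ) : ℝ)) ^ 4 := by gcongr
      _ = _ := by ring
  rw [Real.exp_neg, ← div_eq_mul_inv, le_div_iff₀ (Real.exp_pos _)]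
  calc ((n : ℝ) + n ^ 4) * 3 ^ q * Real.exp (1 / 240 * n)
      ≤ 2 * 24 ^ 4 * ((q + 1 : ℕ) : ℝ) ^ 4 * 3 ^ q * (10 / 9) ^ (q + 1) := by gcongr
    _ = 4 ^ q * (2 * 24 ^ 4 * (4 / 3) * (((q + 1 : ℕ) : ℝ) ^ 4 * (5 / 6) ^ (q + 1))) := by
        have h : (5 / 6 : ℝ) ^ (q + 1) = 3 / 4 * (3 ^ q / 4 ^ q) * (10 / 9) ^ (q + 1) := by
          rw [← div_pow, ← pow_succ', ← mul_pow]
          norm_num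
        rw [h]
        field_simp
    _ ≤ 4 ^ q := mul_le_of_le_one_right (by positivity) hn

theorem eventually_pow_self_mul_le : ∀ᶠ n : ℕ in atTop,
    n ^ n * 2 ^ (n + 1) * 3 ^ (n ^ 2 / 48) ≤ 4 ^ (n ^ 2 / 48) := by
  have hlim : Tendsto (fun m : ℕ => 256 * ((m : ℝ) * (3 / 4) ^ m)) atTop (𝓝 0) := by
    simpa using (tendsto_self_mul_const_pow_of_abs_lt_one
      (r := (3 / 4 : ℝ)) (by rw [abs_of_pos] <;> norm_num)).const_mul (256 : ℝ)
  have hdiv : Tendsto (fun n : ℕ => n / 48 + 1) atTop atTop :=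
    (tendsto_add_atTop_nat 1).comp (Nat.tendsto_div_const_atTop (by norm_num))
  filter_upwards [hdiv.eventually (hlim.eventually_le_const zero_lt_one),
    eventually_ge_atTop 1] with n hn hn1
  set r := n / 48 with hr
  have hbase : 4 * n * 3 ^ r ≤ 4 ^ r := by
    have h : 4 * (48 * (r + 1)) * 3 ^ r ≤ 4 ^ r := by
      rw [div_pow, ← mul_div_assoc, ← mul_div_assoc, div_le_one (by positivity), pow_succ,
        pow_succ] at hn
      have : (4 * (48 * (r + 1)) * 3 ^ r : ℝ) ≤ 4 ^ r := by
        push_cast at hn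
        linarith
      exact_mod_cast this
    refine le_trans ?_ h
    gcongr
    lia
  obtain ⟨d, hd⟩ : ∃ d, n ^ 2 / 48 = r * n + d := by
    refine Nat.exists_eq_add_of_le ?_
    rw [Nat.le_div_iff_mul_le (by norm_num)]
    nlinarith [Nat.div_mul_le_self n 48]
  rw [hd]
  calc n ^ n * 2 ^ (n + 1) * 3 ^ (r * n + d) ≤ n ^ n * 2 ^ (2 * n) * 3 ^ (r * n + d) := by
        gcongr
        · norm_num
        · lia
    _ = (4 * n * 3 ^ r) ^ n * 3 ^ d := by
        rw [mul_pow, mul_pow, pow_add, pow_mul, pow_mul]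
        norm_num
        ring
    _ ≤ (4 ^ r) ^ n * 4 ^ d := by
        gcongr
        norm_num
    _ = 4 ^ (r * n + d) := by rw [pow_add, pow_mul]

theorem two_pow_succ_le_exp {n : ℕ} (hn : 1 ≤ n) : (2 : ℝ) ^ (n + 1) ≤ Real.exp (2 * n) := by
  calc (2 : ℝ) ^ (n + 1) ≤ 2 ^ (2 * n) := by
        gcongr
        · norm_num
        · lia
    _ ≤ Real.exp 1 ^ (2 * n) := by
        gcongr
        linarith [Real.add_one_le_exp 1]
    _ = Real.exp (2 * n) := by
        rw [← Real.exp_nat_mul]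
        simp

end Asymptotics

/-- there are constants `c, C > 0` and a threshold `N₀` such that for every
finite abelian group `G` of order `n ≥ N₀`, with
`M = (|G[2]| / |Aut G|) · 2^{(n² + 3n + 2|G[3]|)/6}` we have
`M·e^{-Cn} ≤ M - 𝒩(G) ≤ M·e^{-cn}`. -/
theorem stmt18 :
    ∃ c C : ℝ, 0 < c ∧ 0 < C ∧ ∃ N₀ : ℕ, ∀ (G : Type) [CommGroup G] [Fintype G],
      N₀ ≤ Fintype.card G →
      (Nat.card {x : G // x ^ 2 = 1} : ℝ) / (Nat.card (G ≃* G) : ℝ) *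
            2 ^ ((Fintype.card G ^ 2 + 3 * Fintype.card G +
              2 * Nat.card {x : G // x ^ 3 = 1}) / 6) *
            Real.exp (-(C * Fintype.card G)) ≤
          (Nat.card {x : G // x ^ 2 = 1} : ℝ) / (Nat.card (G ≃* G) : ℝ) *
            2 ^ ((Fintype.card G ^ 2 + 3 * Fintype.card G +
              2 * Nat.card {x : G // x ^ 3 = 1}) / 6) -
            (numHFClasses G : ℝ) ∧
        (Nat.card {x : G // x ^ 2 = 1} : ℝ) / (Nat.card (G ≃* G) : ℝ) *
            2 ^ ((Fintype.card G ^ 2 + 3 * Fintype.card G +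
              2 * Nat.card {x : G // x ^ 3 = 1}) / 6) -
            (numHFClasses G : ℝ) ≤
          (Nat.card {x : G // x ^ 2 = 1} : ℝ) / (Nat.card (G ≃* G) : ℝ) *
            2 ^ ((Fintype.card G ^ 2 + 3 * Fintype.card G +
              2 * Nat.card {x : G // x ^ 3 = 1}) / 6) *
            Real.exp (-(c * Fintype.card G)) := by
  obtain ⟨N₁, hN₁⟩ := Filter.eventually_atTop.1 eventually_poly_mul_le_exp
  obtain ⟨N₂, hN₂⟩ := Filter.eventually_atTop.1 eventually_pow_self_mul_le
  refine ⟨1 / 240, 2, by norm_num, by norm_num, max 20 (max N₁ N₂), fun G _ _ hG => ?_⟩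
  classical
  have hn : 20 ≤ Fintype.card G := (le_max_left _ _).trans hG
  have h₁ := hN₁ _ (((le_max_left _ _).trans (le_max_right _ _)).trans hG)
  have h₂ := hN₂ _ (((le_max_right _ _).trans (le_max_right _ _)).trans hG)
  rw [← six_mul_card_hexagon G, Nat.mul_div_cancel_left _ (by norm_num)]
  have hsum := card_hfPair_add_sum_card_bad (G := G)
  have hupper := card_hfPair_le G
  have hlower := four_pow_mul_numHFClasses_le (G := G) hn (k := Fintype.card G ^ 2 / 48)
    (Nat.mul_div_le _ _)
  have hbad : 4 ^ (Fintype.card G / 24) *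
      ∑ ε : {x : G // x ^ 2 = 1}, (badHexagonSets ε.1).card ≤
      Nat.card {x : G // x ^ 2 = 1} * ((Fintype.card G + Fintype.card G ^ 4) *
        (3 ^ (Fintype.card G / 24) * 2 ^ Nat.card (Hexagon G))) := by
    rw [Finset.mul_sum]
    refine (Finset.sum_le_card_nsmul _ _ _ fun ε _ =>
      four_pow_mul_card_badHexagonSets_le ε.1 (Nat.mul_div_le _ _)).trans ?_
    rw [Finset.card_univ, ← Nat.card_eq_fintype_card, smul_eq_mul]
  have hbad' : Nat.card {x : G // x ^ 2 = 1} * 2 ^ Nat.card (Hexagon G) ≤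
      2 ^ Fintype.card G * ∑ ε : {x : G // x ^ 2 = 1}, (badHexagonSets ε.1).card := by
    rw [Finset.mul_sum, Nat.card_eq_fintype_card, ← smul_eq_mul, ← Finset.card_univ]
    exact Finset.card_nsmul_le_sum _ _ _ fun ε _ => two_pow_card_hexagon_le ε.1 (by lia)
  have hexp := two_pow_succ_le_exp (n := Fintype.card G) (by lia)
  have hAut : 0 < Nat.card (G ≃* G) := Nat.card_pos
  change Nat.card (HFPair G) ≤ numHFClasses G * Nat.card (G ≃* G) at hupper
  change 4 ^ _ * (numHFClasses G * Nat.card (G ≃* G)) ≤ _ at hlower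
  generalize ∑ ε : {x : G // x ^ 2 = 1}, (badHexagonSets ε.1).card = bad at *
  generalize Nat.card (HFPair G) = P at *
  generalize Nat.card (Hexagon G) = H at *
  generalize Nat.card {x : G // x ^ 2 = 1} = E at *
  generalize numHFClasses G = N at *
  generalize Nat.card (G ≃* G) = A at *
  generalize Fintype.card G = n at *
  generalize n / 24 = k at *
  generalize n ^ 2 / 48 = l at *
  have hA : (0 : ℝ) < A := by exact_mod_cast hAut
  have hsum' : (P : ℝ) + bad = E * 2 ^ H := by exact_mod_cast hsum
  have hupper' : (P : ℝ) ≤ N * A := by exact_mod_cast hupper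
  have hlower' : (4 : ℝ) ^ l * (N * A) ≤ 4 ^ l * P + n ^ n * (E * (3 ^ l * 2 ^ H)) := by
    exact_mod_cast hlower
  have hb : (4 : ℝ) ^ k * bad ≤ E * ((n + n ^ 4) * (3 ^ k * 2 ^ H)) := by exact_mod_cast hbad
  have hb' : (E : ℝ) * 2 ^ H ≤ 2 ^ n * bad := by exact_mod_cast hbad'
  have h₂' : (n : ℝ) ^ n * 2 ^ (n + 1) * 3 ^ l ≤ 4 ^ l := by exact_mod_cast h₂
  have hdiff : (E : ℝ) / A * 2 ^ H - N = (E * 2 ^ H - N * A) / A := by field_simp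
  have hfac : ∀ x : ℝ, (E : ℝ) / A * 2 ^ H * x = E * 2 ^ H * x / A := fun x => by ring
  rw [hdiff, hfac, hfac]
  constructor
  · gcongr
    have hX : (E : ℝ) * 2 ^ H * Real.exp (-(2 * n)) * 2 ^ (n + 1) ≤ E * 2 ^ H := by
      rw [mul_assoc]
      refine mul_le_of_le_one_right (by positivity) ?_
      rw [Real.exp_neg, inv_mul_le_one₀ (Real.exp_pos _)]
      exact hexp
    have hY : 2 ^ (n + 1) * (N * A) ≤ 2 ^ (n + 1) * P + (E * 2 ^ H : ℝ) := by
      have h4 : (0 : ℝ) < 4 ^ l := by positivity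
      refine le_of_mul_le_mul_left ?_ h4
      calc (4 : ℝ) ^ l * (2 ^ (n + 1) * (N * A)) = 2 ^ (n + 1) * (4 ^ l * (N * A)) := by ring
        _ ≤ 2 ^ (n + 1) * (4 ^ l * P + n ^ n * (E * (3 ^ l * 2 ^ H))) := by gcongr
        _ = 4 ^ l * (2 ^ (n + 1) * P) + n ^ n * 2 ^ (n + 1) * 3 ^ l * (E * 2 ^ H) := by ring
        _ ≤ 4 ^ l * (2 ^ (n + 1) * P) + 4 ^ l * (E * 2 ^ H) := by gcongr
        _ = _ := by ring
    have hZ : 2 * (E * 2 ^ H : ℝ) ≤ 2 ^ (n + 1) * (E * 2 ^ H - P) := by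
      rw [← hsum', pow_succ]
      rw [← hsum'] at hb'
      linarith
    have h2 : (0 : ℝ) < 2 ^ (n + 1) := by positivity
    refine le_of_mul_le_mul_left ?_ h2
    linarith
  · gcongr
    have h4 : (0 : ℝ) < 4 ^ k := by positivity
    refine le_of_mul_le_mul_left ?_ h4
    calc (4 : ℝ) ^ k * (E * 2 ^ H - N * A) ≤ 4 ^ k * bad := by
          gcongr
          linarith
      _ ≤ E * ((n + n ^ 4) * (3 ^ k * 2 ^ H)) := hb
      _ = E * 2 ^ H * ((n + n ^ 4) * 3 ^ k) := by ring
      _ ≤ E * 2 ^ H * (4 ^ k * Real.exp (-(1 / 240 * n))) := by gcongr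
      _ = _ := by ring
end
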